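/- For every dimension n, every C₀ > 0, every d₀ > 0 and each k ∈ {1, 2, 3}, there exists a constant C > 0 (depending only on n, C₀ and d₀) with the following property. Let Ω ⊂ ℝⁿ be a bounded convex open domain with B₁(0) ⊆ Ω ⊆ Bₙ(0), let w₁, w₂ ∈ C⁴(Ω̄) be convex functions with det D²wᵢ = 1 in Ω for i = 1, 2 and with the C⁴ norms ‖wᵢ‖_{C⁴(Ω̄)} ≤ C₀, and suppose |w₁ − w₂| ≤ δ in Ω for some δ > 0. Then for every x ∈ Ω with dist(x, ∂Ω) ≥ d₀, the k-th derivatives satisfy |D^k(w₁ − w₂)(x)| ≤ C δ. -/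

import Mathlib

open Set Metric RealInnerProductSpace

noncomputable section

/-- The determinant of the Hessian `D²w(x)` of `w : ℝⁿ → ℝ`. -/
noncomputable def hessDet {n : ℕ} (w : EuclideanSpace ℝ (Fin n) → ℝ)
    (x : EuclideanSpace ℝ (Fin n)) : ℝ :=
  LinearMap.det
    ((fderiv ℝ (gradient w) x : EuclideanSpace ℝ (Fin n) →L[ℝ] EuclideanSpace ℝ (Fin n)) :
      EuclideanSpace ℝ (Fin n) →ₗ[ℝ] EuclideanSpace ℝ (Fin n))

section DerivativeEstimates

set_option maxSynthPendingDepth 4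

/-- The second derivative of a function is nonpositive at a local maximum. -/
theorem second_deriv_nonpos_of_isLocalMax {f f' : ℝ → ℝ} {a f'' : ℝ} (hmax : IsLocalMax f a)
    (hf : ∀ᶠ t in nhds a, HasDerivAt f (f' t) t) (hf' : HasDerivAt f' f'' a) : f'' ≤ 0 := by
  by_contra! hpos
  have hd : deriv f =ᶠ[nhds a] f' := hf.mono fun t ht => ht.deriv
  have hdd : deriv (deriv f) a = f'' := by rw [hd.deriv_eq, hf'.deriv]
  have hmin : IsLocalMin f a :=
    isLocalMin_of_deriv_deriv_pos (by rw [hdd]; exact hpos) hmax.deriv_eq_zero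
      hf.self_of_nhds.continuousAt
  have hconst : f =ᶠ[nhds a] fun _ => f a := by
    filter_upwards [hmax, hmin] with t h1 h2 using le_antisymm h1 h2
  have h0 : deriv (deriv f) a = 0 := by
    rw [hconst.deriv.deriv_eq]; simp
  linarith

section Calculus

variable {E : Type*} [NormedAddCommGroup E] [NormedSpace ℝ E]

/-- Along a line, the derivative of a `C²` function and the derivative of that derivative. -/
theorem hasDerivAt_comp_line {u : E → ℝ} {x : E} (hu : ContDiffAt ℝ 2 u x) (ξ : E) :
    (∀ᶠ t in nhds (0 : ℝ), HasDerivAt (fun t => u (x + t • ξ)) (fderiv ℝ u (x + t • ξ) ξ) t) ∧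
      HasDerivAt (fun t : ℝ => fderiv ℝ u (x + t • ξ) ξ) (fderiv ℝ (fderiv ℝ u) x ξ ξ) 0 := by
  have hline : ∀ t : ℝ, HasDerivAt (fun t : ℝ => x + t • ξ) ξ t := fun t => by
    simpa using ((hasDerivAt_id t).smul_const ξ).const_add x
  have htend : Filter.Tendsto (fun t : ℝ => x + t • ξ) (nhds 0) (nhds x) := by
    simpa using (hline 0).continuousAt.tendsto
  refine ⟨?_, ?_⟩
  · have h : ∀ᶠ y in nhds x, ContDiffAt ℝ 2 u y := hu.eventually (by simp)
    filter_upwards [htend.eventually h] with t ht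
    exact (ht.differentiableAt (by simp)).hasFDerivAt.comp_hasDerivAt t (hline t)
  · have h1 : DifferentiableAt ℝ (fderiv ℝ u) (x + (0 : ℝ) • ξ) := by
      simpa using (hu.fderiv_right (m := 1) (by norm_num)).differentiableAt (by simp)
    have h2 := h1.hasFDerivAt.comp_hasDerivAt (0 : ℝ) (hline 0)
    have h3 := h2.clm_apply (hasDerivAt_const (0 : ℝ) ξ)
    simpa using h3

/-- If `u (x + tξ) - u (y + tη)` is touched from above at `t = 0` by a quadratic polynomial,
then the second derivatives are ordered accordingly. -/
theorem hessian_sub_hessian_le {u : E → ℝ} {x y ξ η : E} {b c : ℝ} (hx : ContDiffAt ℝ 2 u x)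
    (hy : ContDiffAt ℝ 2 u y)
    (h : ∀ᶠ t in nhds (0 : ℝ), u (x + t • ξ) - u (y + t • η) ≤ u x - u y + b * t + c * t ^ 2) :
    fderiv ℝ (fderiv ℝ u) x ξ ξ - fderiv ℝ (fderiv ℝ u) y η η ≤ 2 * c := by
  obtain ⟨hx1, hx2⟩ := hasDerivAt_comp_line hx ξ
  obtain ⟨hy1, hy2⟩ := hasDerivAt_comp_line hy η
  have hq : ∀ t : ℝ, HasDerivAt (fun t : ℝ => b * t + c * t ^ 2) (b + 2 * c * t) t := fun t => by
    convert! ((hasDerivAt_id t).const_mul b).add (((hasDerivAt_id t).pow 2).const_mul c) using 1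
    simp; ring
  have hq2 : HasDerivAt (fun t : ℝ => b + 2 * c * t) (2 * c) 0 := by
    simpa using ((hasDerivAt_id (0 : ℝ)).const_mul (2 * c)).const_add b
  have key := second_deriv_nonpos_of_isLocalMax
    (f := fun t => u (x + t • ξ) - u (y + t • η) - (b * t + c * t ^ 2)) (a := 0)
    (f' := fun t => fderiv ℝ u (x + t • ξ) ξ - fderiv ℝ u (y + t • η) η - (b + 2 * c * t))
    (by
      filter_upwards [h] with t ht
      simp only [zero_smul, add_zero]
      linarith)
    (by
      filter_upwards [hx1, hy1] with t h1 h2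
      exact (h1.sub h2).sub (hq t))
    ((hx2.sub hy2).sub hq2)
  linarith

/-- The Hessian of a convex function is positive semidefinite. -/
theorem hessian_nonneg_of_convexOn {u : E → ℝ} {s : Set E} {x : E} (hs : s ∈ nhds x)
    (hu : ContDiffAt ℝ 2 u x) (hc : ConvexOn ℝ s u) (ξ : E) :
    0 ≤ fderiv ℝ (fderiv ℝ u) x ξ ξ := by
  obtain ⟨hx1, hx2⟩ := hasDerivAt_comp_line hu ξ
  obtain ⟨hy1, hy2⟩ := hasDerivAt_comp_line hu (-ξ)
  have htend : ∀ η : E, Filter.Tendsto (fun t : ℝ => x + t • η) (nhds 0) (nhds x) := fun η => by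
    have : Continuous fun t : ℝ => x + t • η := by fun_prop
    simpa using this.tendsto 0
  have key := second_deriv_nonpos_of_isLocalMax
    (f := fun t => -(u (x + t • ξ) + u (x + t • (-ξ)))) (a := 0)
    (f' := fun t => -(fderiv ℝ u (x + t • ξ) ξ + fderiv ℝ u (x + t • (-ξ)) (-ξ)))
    (by
      filter_upwards [(htend ξ).eventually hs, (htend (-ξ)).eventually hs] with t h1 h2
      replace h1 : x + t • ξ ∈ s := h1
      replace h2 : x + t • (-ξ) ∈ s := h2
      have := hc.2 h1 h2 (by norm_num : (0 : ℝ) ≤ 1 / 2) (by norm_num : (0 : ℝ) ≤ 1 / 2)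
        (by norm_num)
      have hmid : (1 / 2 : ℝ) • (x + t • ξ) + (1 / 2 : ℝ) • (x + t • (-ξ)) = x := by module
      rw [hmid] at this
      simp only [smul_eq_mul] at this
      simp only [zero_smul, add_zero]
      linarith)
    (by
      filter_upwards [hx1, hy1] with t h1 h2
      exact (h1.add h2).neg)
    ((hx2.add hy2).neg)
  simp only [map_neg, _root_.neg_apply, neg_neg] at key
  linarith

end Calculus

section Doubling

variable {E : Type*} [NormedAddCommGroup E] [InnerProductSpace ℝ E]

/-- The real inner product as a continuous bilinear form. -/
noncomputable def innerForm (E : Type*) [NormedAddCommGroup E] [InnerProductSpace ℝ E] :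
    E →L[ℝ] E →L[ℝ] ℝ :=
  (innerₗ E).mkContinuous₂ 1 fun a b => by
    simpa using abs_real_inner_le_norm a b

@[simp] theorem innerForm_apply (a b : E) : innerForm E a b = inner ℝ a b := rfl

theorem norm_innerForm_le : ‖innerForm E‖ ≤ 1 :=
  LinearMap.mkContinuous₂_norm_le _ zero_le_one _

/-- A functional on bilinear forms that controls the norm of every positive semidefinite symmetric
form. -/
def IsElliptic (lam : ℝ) (l : (E →L[ℝ] E →L[ℝ] ℝ) →L[ℝ] ℝ) : Prop :=
  ∀ M : E →L[ℝ] E →L[ℝ] ℝ, (∀ a b, M a b = M b a) → (∀ a, 0 ≤ M a a) → lam * ‖M‖ ≤ l M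

/-- The algebraic core of the doubling argument: ordering of Hessians at a maximum of the doubled
function bounds the difference of the elliptic operators. -/
theorem elliptic_sub_elliptic_le {lam Lam K r τ k m : ℝ} (hlam : 0 < lam) (hr : 0 < r)
    (hK : 0 ≤ K) (hrK : 2 * (K * r) ≤ lam) (hτ : 0 ≤ τ) (hk : 0 ≤ k) (hm : 0 ≤ m)
    {l₁ l₂ : (E →L[ℝ] E →L[ℝ] ℝ) →L[ℝ] ℝ} (hell : IsElliptic lam l₁) (hbd : ‖l₁‖ ≤ Lam)
    (hlip : ‖l₁ - l₂‖ ≤ K * r) {X Y : E →L[ℝ] E →L[ℝ] ℝ} (hX : ∀ a b, X a b = X b a)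
    (hY : ∀ a b, Y a b = Y b a) (hXτ : ∀ a, X a a ≤ τ * ‖a‖ ^ 2)
    (hYτ : ∀ a, -Y a a ≤ τ * ‖a‖ ^ 2) (hXY : ∀ a, X a a - Y a a ≤ k * ‖a‖ ^ 2)
    {e : E} (he : ‖e‖ = 1) (hXYe : X e e - Y e e ≤ k - m) :
    l₁ X - l₂ Y ≤ K * (2 * Lam / lam + 1) * (r * τ) + k * Lam - lam * m / 2 := by
  set I := innerForm E with hI
  have hII : ∀ a : E, I a a = ‖a‖ ^ 2 := fun a => by simp [hI]
  have hIsymm : ∀ a b : E, I a b = I b a := fun a b => by simp [hI, real_inner_comm]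
  have hLam : 0 ≤ Lam := (norm_nonneg _).trans hbd
  have hl₁I : l₁ I ≤ Lam := by
    calc l₁ I ≤ ‖l₁ I‖ := Real.le_norm_self _
      _ ≤ ‖l₁‖ * ‖I‖ := l₁.le_opNorm _
      _ ≤ Lam * 1 := by gcongr; exact norm_innerForm_le
      _ = Lam := mul_one _
  set θ := K * r / lam with hθ
  have hθ0 : 0 ≤ θ := by positivity
  have hθ1 : θ ≤ 1 / 2 := by rw [hθ, div_le_iff₀ hlam]; linarith
  have hθlam : θ * lam = K * r := by rw [hθ]; field_simp
  have hdiff : ∀ M, |l₁ M - l₂ M| ≤ K * r * ‖M‖ := fun M => by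
    have := (l₁ - l₂).le_of_opNorm_le hlip M
    simpa using this
  have hposX : 0 ≤ l₁ (τ • I - X) := by
    refine le_trans (by positivity) (hell (τ • I - X) (fun a b => ?_) fun a => ?_)
    · simp [hIsymm a b, hX a b]
    · simpa [hII] using hXτ a
  have hposY : 0 ≤ (l₂ (τ • I + Y) - l₁ (τ • I + Y)) + θ * l₁ (τ • I + Y) := by
    have h1 := hell (τ • I + Y) (fun a b => by simp [hIsymm a b, hY a b]) fun a => by
      have := hYτ a
      simp only [_root_.add_apply, _root_.smul_apply, hII, smul_eq_mul]
      linarith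
    have h2 := abs_le.1 (hdiff (τ • I + Y))
    have h3 := mul_le_mul_of_nonneg_left h1 hθ0
    rw [← mul_assoc, hθlam] at h3
    linarith [h2.2]
  have hposXY : lam * m ≤ l₁ (k • I - (X - Y)) := by
    have h1 := hell (k • I - (X - Y)) (fun a b => by simp [hIsymm a b, hY a b, hX a b]) fun a => by
      have := hXY a
      simp only [_root_.sub_apply, _root_.smul_apply, hII, smul_eq_mul]
      linarith
    refine le_trans ?_ h1
    gcongr
    calc m ≤ (k • I - (X - Y)) e e := by
            simp only [_root_.sub_apply, _root_.smul_apply, hII, smul_eq_mul, he]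
            linarith
      _ ≤ ‖(k • I - (X - Y)) e e‖ := Real.le_norm_self _
      _ ≤ ‖k • I - (X - Y)‖ * ‖e‖ * ‖e‖ := ContinuousLinearMap.le_opNorm₂ _ _ _
      _ = ‖k • I - (X - Y)‖ := by simp [he]
  have hdI : l₂ I - l₁ I ≤ K * r := by
    have h := (abs_le.1 (hdiff I)).1
    have : K * r * ‖I‖ ≤ K * r * 1 := by gcongr; exact norm_innerForm_le
    linarith
  simp only [map_sub, map_add, map_smul, smul_eq_mul] at hposX hposY hposXY
  have h1 : θ * l₁ X ≤ θ * (τ * Lam) := by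
    gcongr
    have := mul_le_mul_of_nonneg_left hl₁I hτ
    linarith
  have h2 : -(l₂ Y - l₁ Y + θ * l₁ Y) ≤ τ * (K * r) + θ * (τ * Lam) := by
    have e1 := mul_le_mul_of_nonneg_left hl₁I (mul_nonneg hθ0 hτ)
    have e2 := mul_le_mul_of_nonneg_left hdI hτ
    linarith
  have h3 : (1 - θ) * (l₁ X - l₁ Y) ≤ k * Lam - lam * m / 2 := by
    have e1 : l₁ X - l₁ Y ≤ k * Lam - lam * m := by
      have := mul_le_mul_of_nonneg_left hl₁I hk
      linarith
    have e2 := mul_le_mul_of_nonneg_left e1 (by linarith : 0 ≤ 1 - θ)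
    have e3 : 0 ≤ θ * (k * Lam) := by positivity
    have e4 : 0 ≤ (1 / 2 - θ) * (lam * m) := mul_nonneg (by linarith) (by positivity)
    linarith
  have h4 : K * (2 * Lam / lam + 1) * (r * τ) = 2 * (θ * (τ * Lam)) + τ * (K * r) := by
    rw [hθ]; field_simp
  rw [h4]
  linarith

end Doubling

section GradientEstimate

variable {E : Type*} [NormedAddCommGroup E] [InnerProductSpace ℝ E]

theorem norm_add_smul_sq (z ξ : E) (t : ℝ) :
    ‖z + t • ξ‖ ^ 2 = ‖z‖ ^ 2 + 2 * inner ℝ z ξ * t + ‖ξ‖ ^ 2 * t ^ 2 := by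
  rw [norm_add_sq_real, inner_smul_right, norm_smul, mul_pow, Real.norm_eq_abs, sq_abs]
  ring

/-- Second order conditions at an interior maximum, off the diagonal, of the doubled function
`u x - u y - L (‖x - y‖ - κ ‖x - y‖²) - K₀ (‖x - x₀‖² + ‖y - x₀‖²)`. -/
theorem hessian_conditions_of_doubled_max {u : E → ℝ} {x₀ x y : E} {L κ K₀ : ℝ} (hL : 0 ≤ L)
    (hκ : 0 ≤ κ) (hx : ContDiffAt ℝ 2 u x) (hy : ContDiffAt ℝ 2 u y) (hxy : x ≠ y)
    (hmax : ∀ᶠ p : E × E in nhds (x, y),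
      u p.1 - u p.2 - L * (‖p.1 - p.2‖ - κ * ‖p.1 - p.2‖ ^ 2)
          - K₀ * (‖p.1 - x₀‖ ^ 2 + ‖p.2 - x₀‖ ^ 2) ≤
        u x - u y - L * (‖x - y‖ - κ * ‖x - y‖ ^ 2) - K₀ * (‖x - x₀‖ ^ 2 + ‖y - x₀‖ ^ 2)) :
    (∀ a, fderiv ℝ (fderiv ℝ u) x a a ≤ (L / ‖x - y‖ + 2 * K₀) * ‖a‖ ^ 2) ∧
    (∀ a, -fderiv ℝ (fderiv ℝ u) y a a ≤ (L / ‖x - y‖ + 2 * K₀) * ‖a‖ ^ 2) ∧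
    (∀ a, fderiv ℝ (fderiv ℝ u) x a a - fderiv ℝ (fderiv ℝ u) y a a ≤ 4 * K₀ * ‖a‖ ^ 2) ∧
    ∃ e : E, ‖e‖ = 1 ∧
      fderiv ℝ (fderiv ℝ u) x e e - fderiv ℝ (fderiv ℝ u) y e e ≤ 4 * K₀ - 8 * L * κ := by
  set r := ‖x - y‖ with hr
  have hr0 : 0 < r := norm_pos_iff.2 (sub_ne_zero.2 hxy)
  have hline : ∀ ξ η : E, ∀ᶠ t : ℝ in nhds 0,
      u (x + t • ξ) - u (y + t • η)
          - L * (‖(x - y) + t • (ξ - η)‖ - κ * ‖(x - y) + t • (ξ - η)‖ ^ 2)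
          - K₀ * (‖(x - x₀) + t • ξ‖ ^ 2 + ‖(y - x₀) + t • η‖ ^ 2) ≤
        u x - u y - L * (r - κ * r ^ 2) - K₀ * (‖x - x₀‖ ^ 2 + ‖y - x₀‖ ^ 2) := fun ξ η => by
    have hc : Continuous fun t : ℝ => (x + t • ξ, y + t • η) := by fun_prop
    have ht : Filter.Tendsto (fun t : ℝ => (x + t • ξ, y + t • η)) (nhds 0) (nhds (x, y)) := by
      simpa using hc.tendsto 0
    filter_upwards [ht.eventually hmax] with t ht
    have e1 : x + t • ξ - (y + t • η) = (x - y) + t • (ξ - η) := by module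
    have e2 : x + t • ξ - x₀ = (x - x₀) + t • ξ := by module
    have e3 : y + t • η - x₀ = (y - x₀) + t • η := by module
    simpa only [e1, e2, e3] using ht
  have htouch : ∀ s : ℝ, s - κ * s ^ 2 ≤
      (r - κ * r ^ 2) + (1 / (2 * r) - κ) * (s ^ 2 - r ^ 2) := fun s => by
    have h : (s ^ 2 - r ^ 2) / (2 * r) - (s - r) = (s - r) ^ 2 / (2 * r) := by field_simp; ring
    have h2 : 0 ≤ (s - r) ^ 2 / (2 * r) := by positivity
    have h3 : (1 / (2 * r) - κ) * (s ^ 2 - r ^ 2) =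
      (s ^ 2 - r ^ 2) / (2 * r) - κ * (s ^ 2 - r ^ 2) := by ring
    rw [h3]; linarith
  have hcoef : ∀ a : E, 2 * (L * (1 / (2 * r) - κ) * ‖a‖ ^ 2 + K₀ * ‖a‖ ^ 2) ≤
      (L / r + 2 * K₀) * ‖a‖ ^ 2 := fun a => by
    have h : (L / r + 2 * K₀) * ‖a‖ ^ 2 - 2 * (L * (1 / (2 * r) - κ) * ‖a‖ ^ 2 + K₀ * ‖a‖ ^ 2)
        = 2 * L * κ * ‖a‖ ^ 2 := by field_simp; ring
    have : 0 ≤ 2 * L * κ * ‖a‖ ^ 2 := by positivity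
    linarith
  refine ⟨fun a => ?_, fun a => ?_, fun a => ?_, ?_⟩
  · refine le_trans ?_ (hcoef a)
    have h := hessian_sub_hessian_le (ξ := a) (η := 0)
      (b := 2 * L * (1 / (2 * r) - κ) * inner ℝ (x - y) a + 2 * K₀ * inner ℝ (x - x₀) a)
      (c := L * (1 / (2 * r) - κ) * ‖a‖ ^ 2 + K₀ * ‖a‖ ^ 2) hx hy (by
        filter_upwards [hline a 0] with t ht
        have h1 := mul_le_mul_of_nonneg_left (htouch ‖(x - y) + t • a‖) hL
        simp only [smul_zero, add_zero, sub_zero] at ht ⊢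
        rw [norm_add_smul_sq (x - y), ← hr] at h1
        rw [norm_add_smul_sq (x - x₀), norm_add_smul_sq (x - y), ← hr] at ht
        linarith)
    simpa using h
  · refine le_trans ?_ (hcoef a)
    have h := hessian_sub_hessian_le (ξ := 0) (η := a)
      (b := -2 * L * (1 / (2 * r) - κ) * inner ℝ (x - y) a + 2 * K₀ * inner ℝ (y - x₀) a)
      (c := L * (1 / (2 * r) - κ) * ‖a‖ ^ 2 + K₀ * ‖a‖ ^ 2) hx hy (by
        filter_upwards [hline 0 a] with t ht
        have h1 := mul_le_mul_of_nonneg_left (htouch ‖(x - y) + t • (0 - a)‖) hL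
        simp only [smul_zero, add_zero, zero_sub] at ht h1 ⊢
        rw [norm_add_smul_sq (x - y), ← hr, norm_neg, inner_neg_right] at h1
        rw [norm_add_smul_sq (y - x₀), norm_add_smul_sq (x - y), ← hr, norm_neg,
          inner_neg_right] at ht
        linarith)
    simpa using h
  · have h := hessian_sub_hessian_le (ξ := a) (η := a)
      (b := 2 * K₀ * inner ℝ (x - x₀) a + 2 * K₀ * inner ℝ (y - x₀) a)
      (c := 2 * K₀ * ‖a‖ ^ 2) hx hy (by
        filter_upwards [hline a a] with t ht
        simp only [sub_self, smul_zero, add_zero] at ht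
        rw [norm_add_smul_sq (x - x₀), norm_add_smul_sq (y - x₀), ← hr] at ht
        linarith)
    linarith
  · set e : E := r⁻¹ • (x - y) with he
    have hen : ‖e‖ = 1 := by
      rw [he, norm_smul, norm_inv, Real.norm_of_nonneg hr0.le, ← hr, inv_mul_cancel₀ hr0.ne']
    refine ⟨e, hen, ?_⟩
    have h := hessian_sub_hessian_le (ξ := e) (η := -e)
      (b := 2 * L * (1 - 2 * κ * r) + 2 * K₀ * inner ℝ (x - x₀) e - 2 * K₀ * inner ℝ (y - x₀) e)
      (c := -4 * L * κ + 2 * K₀) hx hy (by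
        have hsmall : ∀ᶠ t : ℝ in nhds 0, 0 < r + 2 * t := by
          have : Continuous fun t : ℝ => r + 2 * t := by fun_prop
          exact this.tendsto 0 |>.eventually (lt_mem_nhds (by simpa using hr0))
        filter_upwards [hline e (-e), hsmall] with t ht htr
        have e1 : ‖(x - y) + t • (e - -e)‖ = r + 2 * t := by
          have : (x - y) + t • (e - -e) = (r + 2 * t) • e := by
            have : x - y = r • e := by rw [he, smul_smul, mul_inv_cancel₀ hr0.ne', one_smul]
            rw [this]; module
          rw [this, norm_smul, hen, mul_one, Real.norm_of_nonneg htr.le]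
        rw [e1, norm_add_smul_sq (x - x₀), norm_add_smul_sq (y - x₀), norm_neg, inner_neg_right,
          hen] at ht
        linarith)
    simp only [map_neg, _root_.neg_apply, neg_neg] at h
    linarith

/-- A priori two-point estimate for solutions of elliptic equations with bounded right-hand
side, via doubling of variables. -/
theorem sub_le_of_elliptic [FiniteDimensional ℝ E] {lam Lam K ρ S F L K₀ : ℝ}
    (hlam : 0 < lam) (hK : 0 ≤ K) (hρ : 0 < ρ) (hρK : 4 * (ρ * K) ≤ lam) (hL : 0 ≤ L)
    (hK₀ : 2 * S ≤ K₀ * ρ ^ 2) {x₀ : E} {l : E → (E →L[ℝ] E →L[ℝ] ℝ) →L[ℝ] ℝ}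
    (hell : ∀ x ∈ closedBall x₀ ρ, IsElliptic lam (l x))
    (hbd : ∀ x ∈ closedBall x₀ ρ, ‖l x‖ ≤ Lam)
    (hlip : ∀ x ∈ closedBall x₀ ρ, ∀ y ∈ closedBall x₀ ρ, ‖l x - l y‖ ≤ K * ‖x - y‖)
    {u : E → ℝ} (hu : ∀ x ∈ closedBall x₀ ρ, ContDiffAt ℝ 2 u x)
    (hS : ∀ x ∈ closedBall x₀ ρ, |u x| ≤ S)
    (hF : ∀ x ∈ closedBall x₀ ρ, |l x (fderiv ℝ (fderiv ℝ u) x)| ≤ F)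
    (hbig : K * (2 * Lam / lam + 1) * (L + 4 * K₀ * ρ) + 4 * K₀ * Lam + 2 * F < lam * L / (2 * ρ))
    {x y : E} (hx : x ∈ closedBall x₀ ρ) (hy : y ∈ closedBall x₀ ρ) :
    u x - u y ≤ L * (‖x - y‖ - 1 / (8 * ρ) * ‖x - y‖ ^ 2)
      + K₀ * (‖x - x₀‖ ^ 2 + ‖y - x₀‖ ^ 2) := by
  have hx₀ : x₀ ∈ closedBall x₀ ρ := mem_closedBall_self hρ.le
  have hS0 : 0 ≤ S := (abs_nonneg _).trans (hS _ hx₀)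
  have hLam0 : 0 ≤ Lam := (norm_nonneg _).trans (hbd _ hx₀)
  have hK₀0 : 0 ≤ K₀ := by
    by_contra! h
    have : K₀ * ρ ^ 2 < 0 := mul_neg_of_neg_of_pos h (by positivity)
    linarith
  set κ := 1 / (8 * ρ) with hκ
  have hκ0 : 0 ≤ κ := by positivity
  set Φ : E × E → ℝ := fun p => u p.1 - u p.2 - L * (‖p.1 - p.2‖ - κ * ‖p.1 - p.2‖ ^ 2)
          - K₀ * (‖p.1 - x₀‖ ^ 2 + ‖p.2 - x₀‖ ^ 2) with hΦ
  have hcu : ContinuousOn u (closedBall x₀ ρ) := fun z hz =>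
    (hu z hz).continuousAt.continuousWithinAt
  have hcΦ : ContinuousOn Φ (closedBall x₀ ρ ×ˢ closedBall x₀ ρ) := by
    have h1 : ContinuousOn (fun p : E × E => u p.1) (closedBall x₀ ρ ×ˢ closedBall x₀ ρ) :=
      hcu.comp continuousOn_fst fun p hp => hp.1
    have h2 : ContinuousOn (fun p : E × E => u p.2) (closedBall x₀ ρ ×ˢ closedBall x₀ ρ) :=
      hcu.comp continuousOn_snd fun p hp => hp.2
    have h3 : Continuous (fun p : E × E => L * (‖p.1 - p.2‖ - κ * ‖p.1 - p.2‖ ^ 2)) := by fun_prop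
    have h4 : Continuous (fun p : E × E => K₀ * (‖p.1 - x₀‖ ^ 2 + ‖p.2 - x₀‖ ^ 2)) := by fun_prop
    exact ((h1.sub h2).sub h3.continuousOn).sub h4.continuousOn
  obtain ⟨⟨x', y'⟩, ⟨hx', hy'⟩, hmax⟩ :=
    ((isCompact_closedBall x₀ ρ).prod (isCompact_closedBall x₀ ρ)).exists_isMaxOn
      ⟨(x₀, x₀), hx₀, hx₀⟩ hcΦ
  simp only at hx' hy'
  suffices hneg : Φ (x', y') ≤ 0 by
    have := (hmax (show (x, y) ∈ _ from ⟨hx, hy⟩) : Φ (x, y) ≤ Φ (x', y')).trans hneg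
    simp only [hΦ] at this
    linarith
  by_contra! hpos
  set r := ‖x' - y'‖ with hr
  have hr2 : r ≤ 2 * ρ := by
    have h1 := mem_closedBall_iff_norm.1 hx'
    have h2 := mem_closedBall_iff_norm.1 hy'
    have : x' - y' = (x' - x₀) - (y' - x₀) := by abel
    rw [hr, this]
    exact (norm_sub_le _ _).trans (by linarith)
  have hφ : 0 ≤ L * (r - κ * r ^ 2) := by
    have h : r - κ * r ^ 2 = r * (8 * ρ - r) / (8 * ρ) := by rw [hκ]; field_simp
    have : 0 ≤ r := norm_nonneg _
    have h' : 0 ≤ 8 * ρ - r := by linarith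
    rw [h]; positivity
  have hpos' : K₀ * (‖x' - x₀‖ ^ 2 + ‖y' - x₀‖ ^ 2) < 2 * S := by
    have h1 := abs_le.1 (hS _ hx')
    have h2 := abs_le.1 (hS _ hy')
    simp only [hΦ, ← hr] at hpos
    linarith
  have hK₀lt : ∀ a b : ℝ, 0 ≤ a → 0 ≤ b → K₀ * (a ^ 2 + b ^ 2) < 2 * S → a < ρ := by
    intro a b ha hb hab
    by_contra! h
    have h1 : K₀ * ρ ^ 2 ≤ K₀ * (a ^ 2 + b ^ 2) := by
      gcongr
      have : ρ ^ 2 ≤ a ^ 2 := by gcongr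
      nlinarith [sq_nonneg b]
    linarith
  have hxlt : ‖x' - x₀‖ < ρ := hK₀lt _ _ (norm_nonneg _) (norm_nonneg _) hpos'
  have hylt : ‖y' - x₀‖ < ρ :=
    hK₀lt _ _ (norm_nonneg _) (norm_nonneg _) (by rwa [add_comm (‖y' - x₀‖ ^ 2)])
  have hne : x' ≠ y' := by
    rintro rfl
    have : 0 ≤ K₀ * (‖x' - x₀‖ ^ 2 + ‖x' - x₀‖ ^ 2) := by positivity
    simp [hΦ] at hpos
    linarith
  have hr0 : 0 < r := norm_pos_iff.2 (sub_ne_zero.2 hne)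
  have hloc : ∀ᶠ p : E × E in nhds (x', y'), Φ p ≤ Φ (x', y') := by
    have : closedBall x₀ ρ ×ˢ closedBall x₀ ρ ∈ nhds (x', y') := by
      refine prod_mem_nhds ?_ ?_
      · exact Filter.mem_of_superset (isOpen_ball.mem_nhds (mem_ball_iff_norm.2 hxlt))
          ball_subset_closedBall
      · exact Filter.mem_of_superset (isOpen_ball.mem_nhds (mem_ball_iff_norm.2 hylt))
          ball_subset_closedBall
    filter_upwards [this] with p hp using hmax hp
  obtain ⟨h1, h2, h3, e, he, h4⟩ :=
    hessian_conditions_of_doubled_max hL hκ0 (hu _ hx') (hu _ hy') hne hloc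
  rw [← hr] at h1 h2
  have hsymm : ∀ z ∈ closedBall x₀ ρ, ∀ a b, fderiv ℝ (fderiv ℝ u) z a b =
      fderiv ℝ (fderiv ℝ u) z b a := fun z hz a b =>
    ((hu z hz).isSymmSndFDerivAt (by simp)).eq a b
  have hρr : K * r ≤ K * (2 * ρ) := by gcongr
  have key := elliptic_sub_elliptic_le hlam hr0 hK (by linarith)
    (show 0 ≤ L / r + 2 * K₀ by positivity) (show 0 ≤ 4 * K₀ by positivity)
    (show 0 ≤ 8 * L * κ by positivity) (hell _ hx') (hbd _ hx') (hlip _ hx' _ hy')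
    (hsymm _ hx') (hsymm _ hy') h1 h2 h3 he h4
  have hb1 := abs_le.1 (hF _ hx')
  have hb2 := abs_le.1 (hF _ hy')
  have e1 : r * (L / r + 2 * K₀) ≤ L + 4 * K₀ * ρ := by
    have : r * (L / r + 2 * K₀) = L + 2 * K₀ * r := by field_simp
    rw [this]
    have := mul_le_mul_of_nonneg_left hr2 hK₀0
    linarith
  have e2 : K * (2 * Lam / lam + 1) * (r * (L / r + 2 * K₀)) ≤
      K * (2 * Lam / lam + 1) * (L + 4 * K₀ * ρ) := by gcongr
  have e3 : lam * (8 * L * κ) / 2 = lam * L / (2 * ρ) := by rw [hκ]; field_simp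
  rw [e3] at key
  linarith

/-- Interior gradient estimate for solutions of elliptic equations with Lipschitz coefficients and
bounded right-hand side. -/
theorem norm_fderiv_le_of_elliptic [FiniteDimensional ℝ E] {lam Lam K ρ S F : ℝ}
    (hlam : 0 < lam) (hLam : 0 < Lam) (hK : 0 ≤ K) (hρ : 0 < ρ)
    (hρK : 4 * ρ * (K * (2 * Lam / lam + 1)) ≤ lam)
    {x₀ : E} {l : E → (E →L[ℝ] E →L[ℝ] ℝ) →L[ℝ] ℝ}
    (hell : ∀ x ∈ closedBall x₀ ρ, IsElliptic lam (l x))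
    (hbd : ∀ x ∈ closedBall x₀ ρ, ‖l x‖ ≤ Lam)
    (hlip : ∀ x ∈ closedBall x₀ ρ, ∀ y ∈ closedBall x₀ ρ, ‖l x - l y‖ ≤ K * ‖x - y‖)
    {u : E → ℝ} (hu : ∀ x ∈ closedBall x₀ ρ, ContDiffAt ℝ 2 u x)
    (hS : ∀ x ∈ closedBall x₀ ρ, |u x| ≤ S)
    (hF : ∀ x ∈ closedBall x₀ ρ, |l x (fderiv ℝ (fderiv ℝ u) x)| ≤ F) :
    ‖fderiv ℝ u x₀‖ ≤ 4 * (2 * lam + 8 * Lam + 2) / lam * (S / ρ + ρ * F) := by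
  have hx₀ : x₀ ∈ closedBall x₀ ρ := mem_closedBall_self hρ.le
  have hS0 : 0 ≤ S := (abs_nonneg _).trans (hS _ hx₀)
  have hF0 : 0 ≤ F := (abs_nonneg _).trans (hF _ hx₀)
  have hρK' : 4 * (ρ * K) ≤ lam := by
    refine le_trans ?_ hρK
    have : 0 ≤ ρ * K * (2 * Lam / lam) := by positivity
    linarith
  refine le_of_forall_pos_le_add fun ε hε => ?_
  set K₀ := 2 * S / ρ ^ 2 with hK₀
  set L := 4 * (2 * lam + 8 * Lam + 2) / lam * (S / ρ + ρ * F) + ε / 2 with hL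
  have hL0 : 0 ≤ L := by positivity
  have hK₀0 : 0 ≤ K₀ := by positivity
  have hbig : K * (2 * Lam / lam + 1) * (L + 4 * K₀ * ρ) + 4 * K₀ * Lam + 2 * F <
      lam * L / (2 * ρ) := by
    have h1 : K * (2 * Lam / lam + 1) * (L + 4 * K₀ * ρ) ≤
        lam / (4 * ρ) * (L + 4 * K₀ * ρ) := by
      gcongr
      rw [le_div_iff₀ (by positivity)]; linarith
    have h2 : lam / (4 * ρ) * (L + 4 * K₀ * ρ) = lam * L / (4 * ρ) + lam * K₀ := by field_simp
    have h3 : lam * L / (2 * ρ) = lam * L / (4 * ρ) + lam * L / (4 * ρ) := by field_simp; ring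
    have h4 : lam * L / (4 * ρ) = lam * K₀ + 4 * K₀ * Lam + 2 * F +
        (S / ρ ^ 2 * 2 + (2 * lam + 8 * Lam) * F + lam * ε / (8 * ρ)) := by
      rw [hL, hK₀]; field_simp; ring
    have h5 : 0 < S / ρ ^ 2 * 2 + (2 * lam + 8 * Lam) * F + lam * ε / (8 * ρ) := by positivity
    linarith
  have hK₀S : 2 * S ≤ K₀ * ρ ^ 2 := by rw [hK₀]; field_simp; rfl
  have htwo := @sub_le_of_elliptic E _ _ _ lam Lam K ρ S F L K₀ hlam hK hρ hρK' hL0 hK₀S x₀ l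
    hell hbd hlip u hu hS hF hbig
  have hdrop : ∀ s : ℝ, L * (s - 1 / (8 * ρ) * s ^ 2) ≤ L * s := fun s => by
    gcongr
    have : 0 ≤ 1 / (8 * ρ) * s ^ 2 := by positivity
    linarith
  have hderiv := ((hu x₀ hx₀).differentiableAt (by simp)).hasFDerivAt
  have hsum : 4 * (2 * lam + 8 * Lam + 2) / lam * (S / ρ + ρ * F) + ε = L + ε / 2 := by
    rw [hL]; ring
  rw [hsum]
  refine hderiv.le_of_lip' (by positivity) ?_
  have hsmall : ∀ᶠ x in nhds x₀, K₀ * ‖x - x₀‖ < ε / 2 := by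
    have : Continuous fun x => K₀ * ‖x - x₀‖ := by fun_prop
    exact (this.tendsto x₀).eventually (gt_mem_nhds (by simpa using hε))
  filter_upwards [hsmall, closedBall_mem_nhds x₀ hρ] with x hx hxb
  have h1 := htwo hxb hx₀
  have h2 := htwo hx₀ hxb
  rw [norm_sub_rev x₀ x] at h2
  have h3 := hdrop ‖x - x₀‖
  have h4 : K₀ * ‖x - x₀‖ * ‖x - x₀‖ ≤ ε / 2 * ‖x - x₀‖ := by gcongr
  simp only [sub_self, norm_zero, ne_eq, OfNat.ofNat_ne_zero, not_false_eq_true, zero_pow,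
    add_zero, zero_add] at h1 h2
  rw [Real.norm_eq_abs, abs_le]
  constructor <;> linarith

end GradientEstimate

section Interpolation

variable {E : Type*} [NormedAddCommGroup E] [NormedSpace ℝ E]

theorem mem_closedBall_add_smul {y z e : E} {a h : ℝ} (hh : 0 ≤ h) (he : ‖e‖ = 1)
    (hz : z ∈ closedBall y a) : z + h • e ∈ closedBall y (a + h) := by
  rw [mem_closedBall_iff_norm] at hz ⊢
  calc ‖z + h • e - y‖ = ‖(z - y) + h • e‖ := by congr 1; abel
    _ ≤ ‖z - y‖ + ‖h • e‖ := norm_add_le _ _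
    _ ≤ a + h := by rw [norm_smul, he, mul_one, Real.norm_of_nonneg hh]; linarith

/-- Interpolation: the gradient is controlled by the function and its second derivative. -/
theorem norm_fderiv_le_interpolation {v : E → ℝ} {y : E} {h S A : ℝ} (hh : 0 < h)
    (hv : ∀ z ∈ closedBall y h, ContDiffAt ℝ 2 v z) (hS : ∀ z ∈ closedBall y h, |v z| ≤ S)
    (hA : ∀ z ∈ closedBall y h, ‖fderiv ℝ (fderiv ℝ v) z‖ ≤ A) :
    ‖fderiv ℝ v y‖ ≤ 2 * S / h + h * A := by
  have hy : y ∈ closedBall y h := mem_closedBall_self hh.le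
  have hS0 : 0 ≤ S := (abs_nonneg _).trans (hS y hy)
  have hA0 : 0 ≤ A := (norm_nonneg _).trans (hA y hy)
  refine ContinuousLinearMap.opNorm_le_of_unit_norm (by positivity) fun e he => ?_
  have hz : y + h • e ∈ closedBall y h := by
    simpa using mem_closedBall_add_smul hh.le he (mem_closedBall_self le_rfl : y ∈ closedBall y 0)
  have h1 : ∀ z ∈ closedBall y h, ‖fderiv ℝ v z - fderiv ℝ v y‖ ≤ A * h := fun z hz => by
    refine ((convex_closedBall y h).norm_image_sub_le_of_norm_fderiv_le (𝕜 := ℝ)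
      (fun x hx => ((hv x hx).fderiv_right (m := 1) (by norm_num)).differentiableAt (by simp))
      hA hy hz).trans ?_
    gcongr
    exact mem_closedBall_iff_norm.1 hz
  have h2 := (convex_closedBall y h).norm_image_sub_le_of_norm_fderiv_le' (𝕜 := ℝ)
      (fun x hx => (hv x hx).differentiableAt (by simp)) h1 hy hz
  have e1 : y + h • e - y = h • e := by abel
  rw [e1, norm_smul, he, Real.norm_of_nonneg hh.le, map_smul, smul_eq_mul, mul_one,
    Real.norm_eq_abs, abs_le] at h2
  have b1 := abs_le.1 (hS _ hz)
  have b2 := abs_le.1 (hS _ hy)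
  have key : |h * fderiv ℝ v y e| ≤ 2 * S + A * h * h := by
    rw [abs_le]; constructor <;> linarith
  rw [abs_mul, abs_of_pos hh] at key
  rw [Real.norm_eq_abs]
  have : 2 * S / h + h * A = (2 * S + A * h * h) / h := by field_simp
  rw [this, le_div_iff₀ hh]
  linarith

/-- Interpolation: the Hessian is controlled by the function and its third derivative. -/
theorem norm_hessian_le_interpolation {v : E → ℝ} {y : E} {h S B : ℝ} (hh : 0 < h)
    (hv : ∀ z ∈ closedBall y (2 * h), ContDiffAt ℝ 3 v z)
    (hS : ∀ z ∈ closedBall y (2 * h), |v z| ≤ S)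
    (hB : ∀ z ∈ closedBall y (2 * h), ‖fderiv ℝ (fderiv ℝ (fderiv ℝ v)) z‖ ≤ B) :
    ‖fderiv ℝ (fderiv ℝ v) y‖ ≤ 4 * S / h ^ 2 + 2 * h * B := by
  have hy : y ∈ closedBall y (2 * h) := mem_closedBall_self (by positivity)
  have hyh : y ∈ closedBall y h := mem_closedBall_self hh.le
  have hsub : closedBall y h ⊆ closedBall y (2 * h) := closedBall_subset_closedBall (by linarith)
  have hS0 : 0 ≤ S := (abs_nonneg _).trans (hS y hy)
  have hB0 : 0 ≤ B := (norm_nonneg _).trans (hB y hy)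
  have hv1 : ∀ z ∈ closedBall y (2 * h), ContDiffAt ℝ 2 (fderiv ℝ v) z := fun z hz =>
    (hv z hz).fderiv_right (by norm_num)
  have hv2 : ∀ z ∈ closedBall y (2 * h), ContDiffAt ℝ 1 (fderiv ℝ (fderiv ℝ v)) z := fun z hz =>
    (hv1 z hz).fderiv_right (by norm_num)
  refine ContinuousLinearMap.opNorm_le_of_unit_norm (by positivity) fun e he => ?_
  refine ContinuousLinearMap.opNorm_le_of_unit_norm (by positivity) fun f hf => ?_
  have hshift : ∀ e : E, ‖e‖ = 1 → ∀ z ∈ closedBall y h, z + h • e ∈ closedBall y (2 * h) :=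
    fun e he z hz => by
      have := mem_closedBall_add_smul hh.le he hz
      rwa [two_mul]
  have h1 : ∀ z ∈ closedBall y (2 * h),
      ‖fderiv ℝ (fderiv ℝ v) z - fderiv ℝ (fderiv ℝ v) y‖ ≤ B * (2 * h) := fun z hz => by
    refine ((convex_closedBall y (2 * h)).norm_image_sub_le_of_norm_fderiv_le (𝕜 := ℝ)
      (fun x hx => (hv2 x hx).differentiableAt (by simp)) hB hy hz).trans ?_
    gcongr
    exact mem_closedBall_iff_norm.1 hz
  have h2 : ∀ z ∈ closedBall y h,
      ‖fderiv ℝ (fun z => v (z + h • e) - v z) z - fderiv ℝ (fderiv ℝ v) y (h • e)‖ ≤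
        B * (2 * h) * h := fun z hz => by
    have hd : fderiv ℝ (fun z => v (z + h • e) - v z) z = fderiv ℝ v (z + h • e) - fderiv ℝ v z := by
      rw [fderiv_fun_sub, fderiv_comp_add_right]
      · exact (differentiableAt_comp_add_right _).2
          ((hv _ (hshift e he z hz)).differentiableAt (by simp))
      · exact (hv _ (hsub hz)).differentiableAt (by simp)
    rw [hd]
    have := (convex_closedBall y (2 * h)).norm_image_sub_le_of_norm_fderiv_le' (𝕜 := ℝ)
      (fun x hx => (hv1 x hx).differentiableAt (by simp)) h1 (hsub hz) (hshift e he z hz)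
    have e1 : z + h • e - z = h • e := by abel
    rwa [e1, norm_smul, he, Real.norm_of_nonneg hh.le, mul_one] at this
  have hyf : y + h • f ∈ closedBall y h := by
    simpa using mem_closedBall_add_smul hh.le hf (mem_closedBall_self le_rfl : y ∈ closedBall y 0)
  have h3 := (convex_closedBall y h).norm_image_sub_le_of_norm_fderiv_le' (𝕜 := ℝ)
    (f := fun z => v (z + h • e) - v z)
    (fun z hz => ((differentiableAt_comp_add_right _).2
      ((hv _ (hshift e he z hz)).differentiableAt (by simp))).sub
      ((hv _ (hsub hz)).differentiableAt (by simp))) h2 hyh hyf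
  have e1 : y + h • f - y = h • f := by abel
  rw [e1, norm_smul, hf, Real.norm_of_nonneg hh.le, mul_one, map_smul, map_smul,
    _root_.smul_apply, smul_eq_mul, smul_eq_mul, Real.norm_eq_abs, abs_le] at h3
  have b1 := abs_le.1 (hS _ (hshift e he _ hyf))
  have b2 := abs_le.1 (hS _ (hshift e he _ hyh))
  have b3 := abs_le.1 (hS _ (hsub hyf))
  have b4 := abs_le.1 (hS _ hy)
  have key : |h * (h * fderiv ℝ (fderiv ℝ v) y e f)| ≤ 4 * S + B * (2 * h) * h * h := by
    rw [abs_le]; constructor <;> linarith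
  rw [abs_mul, abs_mul, abs_of_pos hh] at key
  rw [Real.norm_eq_abs]
  have : 4 * S / h ^ 2 + 2 * h * B = (4 * S + B * (2 * h) * h * h) / h ^ 2 := by field_simp
  rw [this, le_div_iff₀ (by positivity)]
  linarith

/-- Absorption argument: a scaled estimate for the third derivative in terms of second and third
derivatives on small balls yields a bound by the supremum of the function itself. -/
theorem exists_norm_third_deriv_le [FiniteDimensional ℝ E] {C₁ ρ₀ R : ℝ} (hC₁ : 0 < C₁)
    (hρ₀ : 0 < ρ₀) (hR : 0 < R) (hR1 : R ≤ 1) : ∃ C > 0, ∀ (v : E → ℝ) (x₀ : E) (S : ℝ),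
      (∀ z ∈ closedBall x₀ R, ContDiffAt ℝ 4 v z) → (∀ z ∈ closedBall x₀ R, |v z| ≤ S) →
      (∀ y ρ A B, 0 < ρ → ρ ≤ ρ₀ → closedBall y ρ ⊆ closedBall x₀ R →
        (∀ z ∈ closedBall y ρ, ‖fderiv ℝ (fderiv ℝ v) z‖ ≤ A) →
        (∀ z ∈ closedBall y ρ, ‖fderiv ℝ (fderiv ℝ (fderiv ℝ v)) z‖ ≤ B) →
        ‖fderiv ℝ (fderiv ℝ (fderiv ℝ v)) y‖ ≤ C₁ * (A / ρ + ρ * (A + B))) →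
      ‖fderiv ℝ (fderiv ℝ (fderiv ℝ v)) x₀‖ ≤ C * S := by
  set ε := min (1 / 4) (min ρ₀ (1 / (32 * C₁))) with hε
  set η := min (1 / 2) (1 / (128 * C₁)) with hη
  have hε0 : 0 < ε := by positivity
  have hη0 : 0 < η := by positivity
  have hε1 : ε ≤ 1 / 4 := min_le_left _ _
  have hε2 : ε ≤ ρ₀ := (min_le_right _ _).trans (min_le_left _ _)
  have hε3 : 32 * C₁ * ε ≤ 1 := by
    have : ε ≤ 1 / (32 * C₁) := (min_le_right _ _).trans (min_le_right _ _)
    rw [le_div_iff₀ (by positivity)] at this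
    linarith
  have hη1 : η ≤ 1 / 2 := min_le_left _ _
  have hη2 : 128 * C₁ * η ≤ 1 := by
    have : η ≤ 1 / (128 * C₁) := min_le_right _ _
    rw [le_div_iff₀ (by positivity)] at this
    linarith
  refine ⟨16 * C₁ / (η ^ 2 * ε ^ 3) / R ^ 3, by positivity, fun v x₀ S hv hS hgrad => ?_⟩
  set T : E → (E →L[ℝ] E →L[ℝ] E →L[ℝ] ℝ) := fderiv ℝ (fderiv ℝ (fderiv ℝ v)) with hT
  have hx₀ : x₀ ∈ closedBall x₀ R := mem_closedBall_self hR.le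
  have hS0 : 0 ≤ S := (abs_nonneg _).trans (hS _ hx₀)
  have hTc : ContinuousOn T (closedBall x₀ R) := fun z hz => by
    have h1 : ContDiffAt ℝ 3 (fderiv ℝ v) z := (hv z hz).fderiv_right (by norm_num)
    have h2 : ContDiffAt ℝ 2 (fderiv ℝ (fderiv ℝ v)) z := h1.fderiv_right (by norm_num)
    have h3 : ContDiffAt ℝ 1 T z := h2.fderiv_right (by norm_num)
    exact h3.continuousAt.continuousWithinAt
  have hgc : ContinuousOn (fun z => (R - ‖z - x₀‖) ^ 3 * ‖T z‖) (closedBall x₀ R) := by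
    have : Continuous fun z => (R - ‖z - x₀‖) ^ 3 := by fun_prop
    exact this.continuousOn.mul hTc.norm
  obtain ⟨x', hx', hmax⟩ := (isCompact_closedBall x₀ R).exists_isMaxOn ⟨x₀, hx₀⟩ hgc
  set d := R - ‖x' - x₀‖ with hd
  have hd0 : 0 ≤ d := by rw [hd, sub_nonneg]; exact mem_closedBall_iff_norm.1 hx'
  have hdR : d ≤ 1 := by have := norm_nonneg (x' - x₀); linarith
  suffices hmain : d ^ 3 * ‖T x'‖ ≤ 16 * C₁ / (η ^ 2 * ε ^ 3) * S by
    have h0 : R ^ 3 * ‖T x₀‖ ≤ d ^ 3 * ‖T x'‖ := by simpa using hmax hx₀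
    rw [div_mul_eq_mul_div, le_div_iff₀ (by positivity)]
    linarith
  rcases hd0.eq_or_lt with hd0 | hd0
  · rw [← hd0]; simp only [ne_eq, OfNat.ofNat_ne_zero, not_false_eq_true, zero_pow, zero_mul]
    positivity
  have hball : ∀ z ∈ closedBall x' (d / 2), z ∈ closedBall x₀ R ∧ ‖T z‖ ≤ 8 * ‖T x'‖ := by
    intro z hz
    rw [mem_closedBall_iff_norm] at hz
    have hzx : ‖z - x₀‖ ≤ ‖z - x'‖ + ‖x' - x₀‖ := norm_sub_le_norm_sub_add_norm_sub _ _ _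
    have hzR : z ∈ closedBall x₀ R := by rw [mem_closedBall_iff_norm]; linarith
    refine ⟨hzR, ?_⟩
    have h1 : (R - ‖z - x₀‖) ^ 3 * ‖T z‖ ≤ d ^ 3 * ‖T x'‖ := hmax hzR
    have h2 : (d / 2) ^ 3 * ‖T z‖ ≤ (R - ‖z - x₀‖) ^ 3 * ‖T z‖ := by
      gcongr; linarith
    have h3 : d ^ 3 * ‖T z‖ ≤ d ^ 3 * (8 * ‖T x'‖) := by linarith
    exact le_of_mul_le_mul_left h3 (by positivity)
  set ρ := ε * d with hρ
  set h := η * ρ with hh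
  have hρ0 : 0 < ρ := by positivity
  have hh0 : 0 < h := by positivity
  have hρd : ρ ≤ d / 4 := by have := mul_le_mul_of_nonneg_right hε1 hd0.le; linarith
  have hhρ : h ≤ ρ / 2 := by have := mul_le_mul_of_nonneg_right hη1 hρ0.le; linarith
  have hρ1 : ρ ≤ ε := by have := mul_le_mul_of_nonneg_left hdR hε0.le; linarith
  have hsub1 : closedBall x' ρ ⊆ closedBall x' (d / 2) :=
    closedBall_subset_closedBall (by linarith)
  set A := 4 * S / h ^ 2 + 2 * h * (8 * ‖T x'‖) with hA
  have hA0 : 0 ≤ A := by positivity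
  have hHess : ∀ z ∈ closedBall x' ρ, ‖fderiv ℝ (fderiv ℝ v) z‖ ≤ A := by
    intro z hz
    have hsub : closedBall z (2 * h) ⊆ closedBall x' (d / 2) := by
      refine closedBall_subset_closedBall' ?_
      have := mem_closedBall.1 hz
      linarith
    exact norm_hessian_le_interpolation hh0
      (fun y hy => (hv y (hball y (hsub hy)).1).of_le (by norm_num))
      (fun y hy => hS y (hball y (hsub hy)).1) (fun y hy => (hball y (hsub hy)).2)
  have key := hgrad x' ρ A (8 * ‖T x'‖) hρ0 (by linarith)
    (fun z hz => (hball z (hsub1 hz)).1) hHess (fun z hz => (hball z (hsub1 hz)).2)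
  have hρA : ρ * A ≤ A / ρ := by
    rw [le_div_iff₀ hρ0]
    have : ρ * ρ ≤ 1 := by nlinarith
    nlinarith
  have hk1 : ‖T x'‖ ≤ C₁ * (2 * (A / ρ) + 8 * ρ * ‖T x'‖) := by
    refine key.trans (mul_le_mul_of_nonneg_left ?_ hC₁.le)
    linarith
  have hAρ : A / ρ = 4 * S / (η ^ 2 * ρ ^ 3) + 16 * η * ‖T x'‖ := by
    rw [hA, hh]; field_simp; ring
  have hk2 : C₁ * (8 * ρ * ‖T x'‖) ≤ 1 / 4 * ‖T x'‖ := by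
    have : C₁ * (8 * ρ) ≤ 1 / 4 := by
      have := mul_le_mul_of_nonneg_left hρ1 hC₁.le
      linarith
    have := mul_le_mul_of_nonneg_right this (norm_nonneg (T x'))
    linarith
  have hk3 : C₁ * (2 * (16 * η * ‖T x'‖)) ≤ 1 / 4 * ‖T x'‖ := by
    have : C₁ * (2 * (16 * η)) ≤ 1 / 4 := by linarith
    have := mul_le_mul_of_nonneg_right this (norm_nonneg (T x'))
    linarith
  rw [hAρ] at hk1
  have hk4 : ‖T x'‖ ≤ 16 * C₁ * S / (η ^ 2 * ρ ^ 3) := by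
    have : 16 * C₁ * S / (η ^ 2 * ρ ^ 3) = 4 * (C₁ * (4 * S / (η ^ 2 * ρ ^ 3))) := by ring
    linarith
  calc d ^ 3 * ‖T x'‖ ≤ d ^ 3 * (16 * C₁ * S / (η ^ 2 * ρ ^ 3)) := by gcongr
    _ = 16 * C₁ / (η ^ 2 * ε ^ 3) * S := by rw [hρ]; field_simp

end Interpolation

section Determinant

variable {ι : Type*} [Fintype ι] [DecidableEq ι] {E : Type*} [NormedAddCommGroup E]
  [InnerProductSpace ℝ E] (e : OrthonormalBasis ι ℝ E)

/-- The matrix of a bilinear form in an orthonormal basis. -/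
def bilinMatrix (B : E →L[ℝ] E →L[ℝ] ℝ) : Matrix ι ι ℝ := Matrix.of fun i j => B (e i) (e j)

/-- The determinant of a bilinear form in an orthonormal basis. -/
def bilinDet (B : E →L[ℝ] E →L[ℝ] ℝ) : ℝ := (bilinMatrix e B).det

omit [DecidableEq ι] in
theorem bilin_apply_eq (B : E →L[ℝ] E →L[ℝ] ℝ) (x : ι → ℝ) :
    B (∑ i, x i • e i) (∑ i, x i • e i) = x ⬝ᵥ (bilinMatrix e B).mulVec x := by
  simp only [map_sum, map_smul, _root_.sum_apply, _root_.smul_apply, smul_eq_mul,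
    dotProduct, Matrix.mulVec, bilinMatrix, Matrix.of_apply, Finset.mul_sum]
  rw [Finset.sum_comm]
  exact Finset.sum_congr rfl fun i _ => Finset.sum_congr rfl fun j _ => by ring

theorem contDiff_bilinDet {n : WithTop ℕ∞} : ContDiff ℝ n (bilinDet e) := by
  unfold bilinDet bilinMatrix
  simp only [Matrix.det_apply, Matrix.of_apply]
  fun_prop

omit [DecidableEq ι] in
theorem bilinMatrix_posSemidef {B : E →L[ℝ] E →L[ℝ] ℝ} (hs : ∀ a b, B a b = B b a)
    (hp : ∀ a, 0 ≤ B a a) : (bilinMatrix e B).PosSemidef := by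
  refine Matrix.PosSemidef.of_dotProduct_mulVec_nonneg ?_ fun x => ?_
  · ext i j
    simp [bilinMatrix, hs (e i) (e j)]
  · rw [star_trivial, ← bilin_apply_eq]
    exact hp _

omit [DecidableEq ι] in
theorem eq_zero_of_bilinMatrix_eq_zero {B : E →L[ℝ] E →L[ℝ] ℝ} (h : bilinMatrix e B = 0) :
    B = 0 := by
  ext a b
  obtain ⟨x, rfl⟩ : ∃ x : ι → ℝ, a = ∑ i, x i • e i := ⟨_, (e.sum_repr a).symm⟩
  obtain ⟨y, rfl⟩ : ∃ y : ι → ℝ, b = ∑ i, y i • e i := ⟨_, (e.sum_repr b).symm⟩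
  simp only [map_sum, map_smul, _root_.sum_apply, _root_.smul_apply, smul_eq_mul,
    _root_.zero_apply]
  have : ∀ i j, B (e i) (e j) = 0 := fun i j => congrFun (congrFun h i) j
  simp [this]

/-- Jacobi's formula for the derivative of the determinant of bilinear forms. -/
theorem fderiv_bilinDet {W : E →L[ℝ] E →L[ℝ] ℝ} (hW : bilinDet e W = 1)
    (M : E →L[ℝ] E →L[ℝ] ℝ) :
    fderiv ℝ (bilinDet e) W M = ((bilinMatrix e W)⁻¹ * bilinMatrix e M).trace := by
  have hunit : IsUnit (bilinMatrix e W).det := by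
    rw [show (bilinMatrix e W).det = 1 from hW]; exact isUnit_one
  have h1 : HasDerivAt (fun t : ℝ => bilinDet e (W + t • M)) (fderiv ℝ (bilinDet e) W M) 0 := by
    have hd : HasDerivAt (fun t : ℝ => W + t • M) M 0 := by
      simpa using ((hasDerivAt_id (0 : ℝ)).smul_const M).const_add W
    have hF : HasFDerivAt (bilinDet e) (fderiv ℝ (bilinDet e) W) (W + (0 : ℝ) • M) := by
      rw [zero_smul, add_zero]
      exact ((contDiff_bilinDet (n := 1) e).differentiable (by simp) W).hasFDerivAt
    exact hF.comp_hasDerivAt 0 hd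
  set N := (bilinMatrix e W)⁻¹ * bilinMatrix e M with hN
  have h2 : ∀ t : ℝ, bilinDet e (W + t • M) = (1 + t • N).det := fun t => by
    have : bilinMatrix e (W + t • M) = bilinMatrix e W * (1 + t • N) := by
      rw [mul_add, mul_one, mul_smul_comm, hN, Matrix.mul_nonsing_inv_cancel_left _ _ hunit]
      ext i j
      simp [bilinMatrix]
    rw [bilinDet, this, Matrix.det_mul, show (bilinMatrix e W).det = 1 from hW, one_mul]
  simp only [h2] at h1
  have h3 : HasDerivAt (fun t : ℝ => (1 + t • N).det) N.trace 0 := by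
    have := Matrix.derivative_det_one_add_X_smul N
    have hp : ∀ t : ℝ, (1 + t • N).det =
        (Matrix.det (1 + (Polynomial.X : Polynomial ℝ) • N.map Polynomial.C)).eval t :=
      fun t => by
        rw [← Polynomial.coe_evalRingHom, RingHom.map_det]
        congr 1
        ext i j
        by_cases hij : i = j <;> simp [hij, mul_comm t]
    simp only [hp]
    rw [← this]
    exact Polynomial.hasDerivAt _ _
  exact h1.unique h3

open scoped MatrixOrder in
omit [DecidableEq ι] in
theorem exists_conjTranspose_mul_self {A : Matrix ι ι ℝ} (hA : A.PosSemidef) :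
    ∃ B : Matrix ι ι ℝ, A = B.conjTranspose * B := by
  classical
  exact CStarAlgebra.nonneg_iff_eq_star_mul_self.1 hA.nonneg

theorem fderiv_bilinDet_pos {W M : E →L[ℝ] E →L[ℝ] ℝ} (hW : bilinDet e W = 1)
    (hWs : ∀ a b, W a b = W b a) (hWp : ∀ a, 0 ≤ W a a) (hMs : ∀ a b, M a b = M b a)
    (hMp : ∀ a, 0 ≤ M a a) (hM : M ≠ 0) : 0 < fderiv ℝ (bilinDet e) W M := by
  have hunit : IsUnit (bilinMatrix e W).det := by
    rw [show (bilinMatrix e W).det = 1 from hW]; exact isUnit_one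
  rw [fderiv_bilinDet e hW]
  obtain ⟨C, hC⟩ := exists_conjTranspose_mul_self (bilinMatrix_posSemidef e hWs hWp).inv
  obtain ⟨B, hB⟩ := exists_conjTranspose_mul_self (bilinMatrix_posSemidef e hMs hMp)
  have htr : ((bilinMatrix e W)⁻¹ * bilinMatrix e M).trace =
      ((C * B.conjTranspose) * (C * B.conjTranspose).conjTranspose).trace := by
    rw [hC, hB, Matrix.conjTranspose_mul, Matrix.conjTranspose_conjTranspose, Matrix.mul_assoc,
      Matrix.trace_mul_comm]
    simp only [Matrix.mul_assoc]
  rw [htr]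
  refine lt_of_le_of_ne (Matrix.posSemidef_self_mul_conjTranspose _).trace_nonneg fun h => hM ?_
  have hX := Matrix.trace_mul_conjTranspose_self_eq_zero_iff.1 h.symm
  have h1 : (bilinMatrix e W)⁻¹ * B.conjTranspose = 0 := by
    rw [hC, Matrix.mul_assoc, hX, Matrix.mul_zero]
  have h2 : B.conjTranspose = 0 := by
    rw [← Matrix.mul_nonsing_inv_cancel_left _ B.conjTranspose hunit, h1, Matrix.mul_zero]
  exact eq_zero_of_bilinMatrix_eq_zero e (by rw [hB, h2, Matrix.zero_mul])

/-- Uniform ellipticity of the linearised determinant on bounded sets of positive forms with unit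
determinant. -/
theorem exists_isElliptic_fderiv_bilinDet [FiniteDimensional ℝ E] (C : ℝ) :
    ∃ lam > 0, ∀ W : E →L[ℝ] E →L[ℝ] ℝ, bilinDet e W = 1 → (∀ a b, W a b = W b a) →
      (∀ a, 0 ≤ W a a) → ‖W‖ ≤ C → IsElliptic lam (fderiv ℝ (bilinDet e) W) := by
  set P : Set (E →L[ℝ] E →L[ℝ] ℝ) := {W | (∀ a b, W a b = W b a) ∧ ∀ a, 0 ≤ W a a} with hP
  have hPc : IsClosed P := by
    rw [hP]
    simp only [ofPred_and, ofPred_forall]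
    refine (isClosed_iInter fun a => isClosed_iInter fun b => isClosed_eq ?_ ?_).inter
      (isClosed_iInter fun a => isClosed_le ?_ ?_) <;> fun_prop
  have hdet : Continuous (bilinDet e) := (contDiff_bilinDet (n := 0) e).continuous
  have hdet' : Continuous (fderiv ℝ (bilinDet e)) :=
    (contDiff_bilinDet (n := 1) e).continuous_fderiv (by simp)
  set Q := (closedBall (0 : E →L[ℝ] E →L[ℝ] ℝ) C ∩ (P ∩ bilinDet e ⁻¹' {1})) ×ˢ
    (sphere (0 : E →L[ℝ] E →L[ℝ] ℝ) 1 ∩ P) with hQ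
  have hQc : IsCompact Q := by
    refine IsCompact.prod ?_ ?_
    · exact (isCompact_closedBall _ _).inter_right
        (hPc.inter (isClosed_singleton.preimage hdet))
    · exact (isCompact_sphere _ _).inter_right hPc
  obtain ⟨lam, hlam, hQl⟩ : ∃ lam > 0, ∀ p ∈ Q, lam ≤ fderiv ℝ (bilinDet e) p.1 p.2 := by
    have hcont : Continuous fun p : (E →L[ℝ] E →L[ℝ] ℝ) × (E →L[ℝ] E →L[ℝ] ℝ) =>
        fderiv ℝ (bilinDet e) p.1 p.2 := by fun_prop
    rcases Q.eq_empty_or_nonempty with h | h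
    · exact ⟨1, one_pos, fun p hp => by rw [h] at hp; exact hp.elim⟩
    obtain ⟨p, hp, hmin⟩ := hQc.exists_isMinOn h hcont.continuousOn
    refine ⟨_, ?_, fun q hq => hmin hq⟩
    obtain ⟨⟨_, hW, hW1⟩, hM1, hM⟩ := hp
    refine fderiv_bilinDet_pos e hW1 hW.1 hW.2 hM.1 hM.2 fun h => ?_
    simp [h] at hM1
  refine ⟨lam, hlam, fun W hW hWs hWp hWC M hMs hMp => ?_⟩
  rcases eq_or_ne M 0 with rfl | hM
  · simp
  have hn : 0 < ‖M‖ := norm_pos_iff.2 hM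
  have := hQl (W, ‖M‖⁻¹ • M) ⟨⟨by simpa using hWC, ⟨hWs, hWp⟩, hW⟩,
    by simp [norm_smul, hn.ne'], fun a b => by simp [hMs a b], fun a => by
      have := hMp a
      simp only [_root_.smul_apply, smul_eq_mul]
      positivity⟩
  simp only [map_smul, smul_eq_mul] at this
  rwa [inv_mul_eq_div, le_div_iff₀ hn] at this

end Determinant

section HigherDerivatives

variable {E F : Type*} [NormedAddCommGroup E] [NormedSpace ℝ E] [NormedAddCommGroup F]
  [NormedSpace ℝ F]

theorem fderiv_apply_const {g : E → E →L[ℝ] F} {x : E} (hg : DifferentiableAt ℝ g x) (a c : E) :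
    fderiv ℝ (fun z => g z a) x c = fderiv ℝ g x c a := by
  have := (hg.hasFDerivAt.clm_apply (hasFDerivAt_const a x)).fderiv
  rw [this]
  simp

theorem second_deriv_symm {f : E → F} {x : E} (hf : ContDiffAt ℝ 2 f x) (c d : E) :
    fderiv ℝ (fderiv ℝ f) x c d = fderiv ℝ (fderiv ℝ f) x d c :=
  (hf.isSymmSndFDerivAt (by simp)).eq c d

theorem third_deriv_symm {f : E → F} {x : E} (hf : ContDiffAt ℝ 3 f x) (c d b : E) :
    fderiv ℝ (fderiv ℝ (fderiv ℝ f)) x c d b = fderiv ℝ (fderiv ℝ (fderiv ℝ f)) x c b d := by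
  have h1 : ContDiffAt ℝ 2 (fderiv ℝ f) x := hf.fderiv_right (by norm_num)
  have h2 : DifferentiableAt ℝ (fderiv ℝ (fderiv ℝ f)) x :=
    (h1.fderiv_right (m := 1) (by norm_num)).differentiableAt (by simp)
  have h3 : ∀ a, DifferentiableAt ℝ (fun z => fderiv ℝ (fderiv ℝ f) z a) x := fun a =>
    h2.clm_apply (differentiableAt_const a)
  have hev : (fun z => fderiv ℝ (fderiv ℝ f) z d b) =ᶠ[nhds x]
      fun z => fderiv ℝ (fderiv ℝ f) z b d := by
    filter_upwards [hf.eventually (by simp)] with z hz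
    exact second_deriv_symm (hz.of_le (by norm_num)) d b
  have := congrArg (fun l : E →L[ℝ] F => l c) hev.fderiv_eq
  simpa only [fderiv_apply_const (h3 _), fderiv_apply_const h2] using this

theorem fourth_deriv_symm {f : E → F} {x : E} (hf : ContDiffAt ℝ 4 f x) (c d a b : E) :
    fderiv ℝ (fderiv ℝ (fderiv ℝ (fderiv ℝ f))) x c d a b =
      fderiv ℝ (fderiv ℝ (fderiv ℝ (fderiv ℝ f))) x a b c d := by
  set T := fderiv ℝ (fderiv ℝ (fderiv ℝ (fderiv ℝ f))) x with hT
  have h1 : ContDiffAt ℝ 3 (fderiv ℝ f) x := hf.fderiv_right (by norm_num)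
  have h2 : ContDiffAt ℝ 2 (fderiv ℝ (fderiv ℝ f)) x := h1.fderiv_right (by norm_num)
  have h3 : DifferentiableAt ℝ (fderiv ℝ (fderiv ℝ (fderiv ℝ f))) x :=
    (h2.fderiv_right (m := 1) (by norm_num)).differentiableAt (by simp)
  have h4 : ∀ a, DifferentiableAt ℝ (fun z => fderiv ℝ (fderiv ℝ (fderiv ℝ f)) z a) x := fun a =>
    h3.clm_apply (differentiableAt_const a)
  have h5 : ∀ a b, DifferentiableAt ℝ (fun z => fderiv ℝ (fderiv ℝ (fderiv ℝ f)) z a b) x :=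
    fun a b => (h4 a).clm_apply (differentiableAt_const b)
  have s12 : ∀ c d a b, T c d a b = T d c a b := fun c d a b => by
    rw [hT, second_deriv_symm h2 c d]
  have s23 : ∀ c d a b, T c d a b = T c a d b := fun c d a b => by
    rw [hT, third_deriv_symm h1 c d a]
  have s34 : ∀ c d a b, T c d a b = T c d b a := fun c d a b => by
    have hev : (fun z => fderiv ℝ (fderiv ℝ (fderiv ℝ f)) z d a b) =ᶠ[nhds x]
        fun z => fderiv ℝ (fderiv ℝ (fderiv ℝ f)) z d b a := by
      filter_upwards [hf.eventually (by simp)] with z hz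
      exact third_deriv_symm (hz.of_le (by norm_num)) d a b
    have := congrArg (fun l : E →L[ℝ] F => l c) hev.fderiv_eq
    simpa only [fderiv_apply_const (h5 _ _), fderiv_apply_const (h4 _), fderiv_apply_const h3]
      using this
  rw [s23 c d a b, s12 c a d b, s34 a c d b, s23 a c b d]

/-- Differentiating a fully nonlinear equation twice. -/
theorem second_deriv_comp_eq_zero {V : Type*} [NormedAddCommGroup V] [NormedSpace ℝ V]
    {Φ : V → ℝ} (hΦ : ContDiff ℝ 2 Φ) {H : E → V} {x : E} (hH : ContDiffAt ℝ 2 H x)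
    {k : ℝ} (heq : ∀ᶠ z in nhds x, Φ (H z) = k) (a b : E) :
    fderiv ℝ (fderiv ℝ Φ) (H x) (fderiv ℝ H x a) (fderiv ℝ H x b) +
      fderiv ℝ Φ (H x) (fderiv ℝ (fderiv ℝ H) x a b) = 0 := by
  have hdΦ : Differentiable ℝ Φ := hΦ.differentiable (by simp)
  have hd2Φ : Differentiable ℝ (fderiv ℝ Φ) :=
    (hΦ.fderiv_right (m := 1) (by norm_num)).differentiable (by simp)
  have hfirst : ∀ᶠ z in nhds x, fderiv ℝ Φ (H z) (fderiv ℝ H z b) = 0 := by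
    filter_upwards [heq.eventually_nhds, hH.eventually (by simp)] with z hz hHz
    have h1 : HasFDerivAt (fun z => Φ (H z)) (fderiv ℝ Φ (H z) ∘L fderiv ℝ H z) z :=
      (hdΦ (H z)).hasFDerivAt.comp z (hHz.differentiableAt (by simp)).hasFDerivAt
    have h2 : HasFDerivAt (fun z => Φ (H z)) (0 : E →L[ℝ] ℝ) z :=
      (hasFDerivAt_const k z).congr_of_eventuallyEq hz
    exact congrArg (fun l => l b) (h1.unique h2)
  have hDH : DifferentiableAt ℝ (fderiv ℝ H) x :=
    (hH.fderiv_right (m := 1) (by norm_num)).differentiableAt (by simp)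
  have h1 := ((hd2Φ (H x)).hasFDerivAt.comp x
    (hH.differentiableAt (by simp)).hasFDerivAt).clm_apply
    (hDH.hasFDerivAt.clm_apply (hasFDerivAt_const b x))
  have h2 := h1.unique ((hasFDerivAt_const (0 : ℝ) x).congr_of_eventuallyEq hfirst)
  have h3 := congrArg (fun l => l a) h2
  simp at h3
  linarith

end HigherDerivatives

section HessianDeterminant

theorem hessDet_eq_bilinDet {n : ℕ} {w : EuclideanSpace ℝ (Fin n) → ℝ}
    {x : EuclideanSpace ℝ (Fin n)} (hw : ContDiffAt ℝ 2 w x) :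
    hessDet w x =
      bilinDet (EuclideanSpace.basisFun (Fin n) ℝ) (fderiv ℝ (fderiv ℝ w) x) := by
  set e := EuclideanSpace.basisFun (Fin n) ℝ with he
  have hD : DifferentiableAt ℝ (fderiv ℝ w) x :=
    (hw.fderiv_right (m := 1) (by norm_num)).differentiableAt (by simp)
  have hcoord : ∀ i, (fun y => gradient w y i) = fun y => fderiv ℝ w y (e i) := fun i => by
    funext y
    have h1 : inner ℝ (gradient w y) (e i) = fderiv ℝ w y (e i) :=
      InnerProductSpace.toDual_symm_apply
    rw [← h1, real_inner_comm, he, EuclideanSpace.basisFun_inner]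
  have hgrad : DifferentiableAt ℝ (gradient w) x := by
    rw [differentiableAt_euclidean]
    intro i
    rw [hcoord i]
    exact hD.clm_apply (differentiableAt_const _)
  have hentry : ∀ i j, (fderiv ℝ (gradient w) x (e j)) i = fderiv ℝ (fderiv ℝ w) x (e j) (e i) :=
    fun i j => by
      have h0 := hasFDerivWithinAt_euclidean.1 (hasFDerivWithinAt_univ.2 hgrad.hasFDerivAt) i
      have h1 := (hasFDerivWithinAt_univ.1 h0).fderiv
      rw [hcoord i] at h1
      rw [← fderiv_apply_const hD, h1]
      rfl
  rw [hessDet, ← LinearMap.det_toMatrix e.toBasis, bilinDet, ← Matrix.det_transpose]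
  congr 1
  ext i j
  rw [Matrix.transpose_apply, LinearMap.toMatrix_apply]
  simpa [bilinMatrix, he] using hentry j i

end HessianDeterminant

section Difference

variable {ι : Type*} [Fintype ι] [DecidableEq ι] {E : Type*} [NormedAddCommGroup E]
  [InnerProductSpace ℝ E] (e : OrthonormalBasis ι ℝ E)

/-- At the point `z`, the function `w` solves the Monge-Ampère equation with unit right-hand side,
has a nonnegative Hessian, and has derivatives of orders two to four bounded by `C`. -/
structure IsBoundedSolutionAt (C : ℝ) (w : E → ℝ) (z : E) : Prop where
  contDiffAt : ContDiffAt ℝ 4 w z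
  bilinDet_eq : bilinDet e (fderiv ℝ (fderiv ℝ w) z) = 1
  nonneg : ∀ a, 0 ≤ fderiv ℝ (fderiv ℝ w) z a a
  norm_two_le : ‖fderiv ℝ (fderiv ℝ w) z‖ ≤ C
  norm_three_le : ‖fderiv ℝ (fderiv ℝ (fderiv ℝ w)) z‖ ≤ C
  norm_four_le : ‖fderiv ℝ (fderiv ℝ (fderiv ℝ (fderiv ℝ w))) z‖ ≤ C

/-- Bound for the difference of two twice differentiated equations. -/
theorem abs_linearized_le {V : Type*} [NormedAddCommGroup V] [NormedSpace ℝ V]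
    {l₁ l₂ : V →L[ℝ] ℝ} {q₁ q₂ : V →L[ℝ] V →L[ℝ] ℝ} {p₁ p₂ p₁' p₂' Q₁ Q₂ : V} {C N A B : ℝ}
    (h₁ : q₁ p₁ p₁' + l₁ Q₁ = 0) (h₂ : q₂ p₂ p₂' + l₂ Q₂ = 0)
    (hl : ‖l₁ - l₂‖ ≤ N * A) (hq : ‖q₁ - q₂‖ ≤ N * A) (hq₂ : ‖q₂‖ ≤ N)
    (hp₁ : ‖p₁‖ ≤ C) (hp₁' : ‖p₁'‖ ≤ C) (hp₂ : ‖p₂‖ ≤ C) (hQ₂ : ‖Q₂‖ ≤ C)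
    (hp : ‖p₁ - p₂‖ ≤ B) (hp' : ‖p₁' - p₂'‖ ≤ B) :
    |l₁ (Q₁ - Q₂)| ≤ N * C * (C + 3) * (A + B) := by
  have hN : 0 ≤ N := (norm_nonneg _).trans hq₂
  have hC : 0 ≤ C := (norm_nonneg _).trans hp₁
  have hB : 0 ≤ B := (norm_nonneg _).trans hp
  have hNA : 0 ≤ N * A := (norm_nonneg _).trans hl
  have key : l₁ (Q₁ - Q₂) = -((q₁ - q₂) p₁ p₁') - q₂ (p₁ - p₂) p₁' - q₂ p₂ (p₁' - p₂') -
      (l₁ - l₂) Q₂ := by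
    simp only [map_sub, _root_.sub_apply]
    linarith
  have e1 : |(q₁ - q₂) p₁ p₁'| ≤ N * A * C * C :=
    ((q₁ - q₂).le_opNorm₂ p₁ p₁').trans (by gcongr)
  have e2 : |q₂ (p₁ - p₂) p₁'| ≤ N * B * C := (q₂.le_opNorm₂ _ _).trans (by gcongr)
  have e3 : |q₂ p₂ (p₁' - p₂')| ≤ N * C * B := (q₂.le_opNorm₂ _ _).trans (by gcongr)
  have e4 : |(l₁ - l₂) Q₂| ≤ N * A * C := ((l₁ - l₂).le_opNorm _).trans (by gcongr)
  have hsum : N * A * C * C + N * B * C + N * C * B + N * A * C ≤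
      N * C * (C + 3) * (A + B) := by
    have h1 : 0 ≤ N * A * C := by positivity
    have h2 : 0 ≤ N * B * C * C := by positivity
    have h3 : 0 ≤ N * B * C := by positivity
    nlinarith
  rw [key]
  rw [abs_le] at *
  constructor <;> linarith [e1.1, e1.2, e2.1, e2.2, e3.1, e3.2, e4.1, e4.2]

/-- A smooth function on a finite-dimensional space has bounded and Lipschitz first and second
derivatives on balls. -/
theorem exists_derivative_bounds {V : Type*} [NormedAddCommGroup V] [NormedSpace ℝ V]
    [FiniteDimensional ℝ V] {Φ : V → ℝ} (hΦ : ContDiff ℝ 3 Φ) (C : ℝ) :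
    ∃ N > 0, (∀ W ∈ closedBall (0 : V) C, ‖fderiv ℝ Φ W‖ ≤ N ∧
        ‖fderiv ℝ (fderiv ℝ Φ) W‖ ≤ N) ∧
      ∀ W ∈ closedBall (0 : V) C, ∀ W' ∈ closedBall (0 : V) C,
        ‖fderiv ℝ Φ W - fderiv ℝ Φ W'‖ ≤ N * ‖W - W'‖ ∧
        ‖fderiv ℝ (fderiv ℝ Φ) W - fderiv ℝ (fderiv ℝ Φ) W'‖ ≤ N * ‖W - W'‖ := by
  have h1 : ContDiff ℝ 2 (fderiv ℝ Φ) := hΦ.fderiv_right (by norm_num)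
  have h2 : ContDiff ℝ 1 (fderiv ℝ (fderiv ℝ Φ)) := h1.fderiv_right (by norm_num)
  have hc : IsCompact (closedBall (0 : V) C) := isCompact_closedBall 0 C
  obtain ⟨N₁, hN₁⟩ := hc.exists_bound_of_continuousOn h1.continuous.continuousOn
  obtain ⟨N₂, hN₂⟩ := hc.exists_bound_of_continuousOn h2.continuous.continuousOn
  obtain ⟨K₁, hK₁⟩ := h1.contDiffOn.exists_lipschitzOnWith (by simp) (convex_closedBall _ _) hc
  obtain ⟨K₂, hK₂⟩ := h2.contDiffOn.exists_lipschitzOnWith (by simp) (convex_closedBall _ _) hc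
  have a1 := le_abs_self N₁
  have a2 := le_abs_self N₂
  have b1 := abs_nonneg N₁
  have b2 := abs_nonneg N₂
  have c1 := K₁.2
  have c2 := K₂.2
  simp only [NNReal.val_eq_coe] at c1 c2
  refine ⟨|N₁| + |N₂| + K₁ + K₂ + 1, by positivity,
    fun W hW => ⟨(hN₁ W hW).trans (by linarith), (hN₂ W hW).trans (by linarith)⟩,
    fun W hW W' hW' => ⟨(hK₁.norm_sub_le hW hW').trans ?_, (hK₂.norm_sub_le hW hW').trans ?_⟩⟩
  all_goals
    gcongr
    linarith

/-- Scaled estimate of the third derivative of the difference of two bounded solutions by its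
second and third derivatives on a ball. -/
theorem exists_norm_third_deriv_sub_le [FiniteDimensional ℝ E] {C₀ : ℝ} (hC₀ : 0 < C₀) :
    ∃ C₁ > 0, ∃ ρ₀ > 0, ∀ (U : Set E) (w₁ w₂ : E → ℝ), IsOpen U →
      (∀ z ∈ U, IsBoundedSolutionAt e C₀ w₁ z) → (∀ z ∈ U, IsBoundedSolutionAt e C₀ w₂ z) →
      ∀ (y : E) (ρ A B : ℝ), 0 < ρ → ρ ≤ ρ₀ → closedBall y ρ ⊆ U →
        (∀ z ∈ closedBall y ρ, ‖fderiv ℝ (fderiv ℝ (fun x => w₁ x - w₂ x)) z‖ ≤ A) →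
        (∀ z ∈ closedBall y ρ,
          ‖fderiv ℝ (fderiv ℝ (fderiv ℝ (fun x => w₁ x - w₂ x))) z‖ ≤ B) →
        ‖fderiv ℝ (fderiv ℝ (fderiv ℝ (fun x => w₁ x - w₂ x))) y‖ ≤
          C₁ * (A / ρ + ρ * (A + B)) := by
  obtain ⟨lam, hlam, hell⟩ := exists_isElliptic_fderiv_bilinDet e C₀
  have hΦ : ContDiff ℝ 3 (bilinDet e) := contDiff_bilinDet e
  obtain ⟨N, hN, hNb, hNl⟩ := exists_derivative_bounds hΦ C₀
  set K := N * C₀ with hK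
  set κ := 4 * (2 * lam + 8 * N + 2) / lam with hκ
  set M := N * C₀ * (C₀ + 3) with hM
  refine ⟨κ * (1 + M), by positivity, lam / (4 * (K * (2 * N / lam + 1))), by positivity,
    fun U w₁ w₂ hU hw₁ hw₂ y ρ A B hρ hρ₀ hball hA hB => ?_⟩
  set v : E → ℝ := fun x => w₁ x - w₂ x with hv
  have hA0 : 0 ≤ A := (norm_nonneg _).trans (hA y (mem_closedBall_self hρ.le))
  have hB0 : 0 ≤ B := (norm_nonneg _).trans (hB y (mem_closedBall_self hρ.le))
  have hv4 : ∀ z ∈ U, ContDiffAt ℝ 4 v z := fun z hz =>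
    (hw₁ z hz).contDiffAt.sub (hw₂ z hz).contDiffAt
  have c1 : ∀ {w : E → ℝ} {z : E}, ContDiffAt ℝ 4 w z → ContDiffAt ℝ 3 (fderiv ℝ w) z :=
    fun h => h.fderiv_right (by norm_num)
  have c2 : ∀ {w : E → ℝ} {z : E}, ContDiffAt ℝ 4 w z → ContDiffAt ℝ 2 (fderiv ℝ (fderiv ℝ w)) z :=
    fun h => (c1 h).fderiv_right (by norm_num)
  have c3 : ∀ {w : E → ℝ} {z : E}, ContDiffAt ℝ 4 w z →
      ContDiffAt ℝ 1 (fderiv ℝ (fderiv ℝ (fderiv ℝ w))) z :=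
    fun h => (c2 h).fderiv_right (by norm_num)
  have d1 : EqOn (fderiv ℝ v) (fun z => fderiv ℝ w₁ z - fderiv ℝ w₂ z) U := fun z hz =>
    fderiv_fun_sub ((hw₁ z hz).contDiffAt.differentiableAt (by simp))
      ((hw₂ z hz).contDiffAt.differentiableAt (by simp))
  have d2 : EqOn (fderiv ℝ (fderiv ℝ v))
      (fun z => fderiv ℝ (fderiv ℝ w₁) z - fderiv ℝ (fderiv ℝ w₂) z) U := fun z hz => by
    rw [(d1.eventuallyEq_of_mem (hU.mem_nhds hz)).fderiv_eq]
    exact fderiv_fun_sub ((c1 (hw₁ z hz).contDiffAt).differentiableAt (by simp))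
      ((c1 (hw₂ z hz).contDiffAt).differentiableAt (by simp))
  have d3 : EqOn (fderiv ℝ (fderiv ℝ (fderiv ℝ v)))
      (fun z => fderiv ℝ (fderiv ℝ (fderiv ℝ w₁)) z - fderiv ℝ (fderiv ℝ (fderiv ℝ w₂)) z) U :=
    fun z hz => by
      rw [(d2.eventuallyEq_of_mem (hU.mem_nhds hz)).fderiv_eq]
      exact fderiv_fun_sub ((c2 (hw₁ z hz).contDiffAt).differentiableAt (by simp))
        ((c2 (hw₂ z hz).contDiffAt).differentiableAt (by simp))
  have d4 : EqOn (fderiv ℝ (fderiv ℝ (fderiv ℝ (fderiv ℝ v))))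
      (fun z => fderiv ℝ (fderiv ℝ (fderiv ℝ (fderiv ℝ w₁))) z -
        fderiv ℝ (fderiv ℝ (fderiv ℝ (fderiv ℝ w₂))) z) U :=
    fun z hz => by
      rw [(d3.eventuallyEq_of_mem (hU.mem_nhds hz)).fderiv_eq]
      exact fderiv_fun_sub ((c3 (hw₁ z hz).contDiffAt).differentiableAt (by simp))
        ((c3 (hw₂ z hz).contDiffAt).differentiableAt (by simp))
  have hyU : y ∈ U := hball (mem_closedBall_self hρ.le)
  have hin₁ : ∀ z ∈ U, fderiv ℝ (fderiv ℝ w₁) z ∈ closedBall (0 : E →L[ℝ] E →L[ℝ] ℝ) C₀ :=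
    fun z hz => mem_closedBall_zero_iff.2 (hw₁ z hz).norm_two_le
  have hin₂ : ∀ z ∈ U, fderiv ℝ (fderiv ℝ w₂) z ∈ closedBall (0 : E →L[ℝ] E →L[ℝ] ℝ) C₀ :=
    fun z hz => mem_closedBall_zero_iff.2 (hw₂ z hz).norm_two_le
  set l : E → (E →L[ℝ] E →L[ℝ] ℝ) →L[ℝ] ℝ :=
    fun z => fderiv ℝ (bilinDet e) (fderiv ℝ (fderiv ℝ w₁) z) with hl
  have hρK : 4 * ρ * (K * (2 * N / lam + 1)) ≤ lam := by
    rw [le_div_iff₀ (by positivity)] at hρ₀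
    linarith
  have hlip : ∀ x ∈ closedBall y ρ, ∀ z ∈ closedBall y ρ, ‖l x - l z‖ ≤ K * ‖x - z‖ := by
    intro x hx z hz
    refine (hNl _ (hin₁ x (hball hx)) _ (hin₁ z (hball hz))).1.trans ?_
    rw [hK, mul_assoc]
    gcongr
    exact (convex_closedBall y ρ).norm_image_sub_le_of_norm_fderiv_le (𝕜 := ℝ)
      (fun x hx => (c2 (hw₁ x (hball hx)).contDiffAt).differentiableAt (by simp))
      (fun x hx => (hw₁ x (hball hx)).norm_three_le) hz hx
  have hest : ∀ a b : E, ‖a‖ = 1 → ‖b‖ = 1 →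
      ‖fderiv ℝ (fun z => fderiv ℝ (fderiv ℝ v) z a b) y‖ ≤ κ * (A / ρ + ρ * (M * (A + B))) := by
    intro a b ha hb
    have hopn : ∀ (T : E →L[ℝ] E →L[ℝ] E →L[ℝ] ℝ) (r : ℝ), ‖T‖ ≤ r → ∀ c : E, ‖c‖ = 1 → ‖T c‖ ≤ r :=
      fun T r hT c hc => by simpa [hc] using T.le_of_opNorm_le hT c
    refine norm_fderiv_le_of_elliptic (l := l) hlam hN (by positivity) hρ hρK
      (fun z hz => ?_) (fun z hz => ?_) hlip (fun z hz => ?_) (fun z hz => ?_) (fun z hz => ?_)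
    · have h := hw₁ z (hball hz)
      exact hell _ h.bilinDet_eq (second_deriv_symm (h.contDiffAt.of_le (by norm_num))) h.nonneg
        h.norm_two_le
    · exact (hNb _ (hin₁ z (hball hz))).1
    · exact ((c2 (hv4 z (hball hz))).clm_apply contDiffAt_const).clm_apply contDiffAt_const
    · have := (fderiv ℝ (fderiv ℝ v) z).le_opNorm₂ a b
      rw [ha, hb, mul_one, mul_one] at this
      exact this.trans (hA z hz)
    · have hzU := hball hz
      have hD : fderiv ℝ (fderiv ℝ (fun z => fderiv ℝ (fderiv ℝ v) z a b)) z =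
          fderiv ℝ (fderiv ℝ (fderiv ℝ (fderiv ℝ w₁))) z a b -
            fderiv ℝ (fderiv ℝ (fderiv ℝ (fderiv ℝ w₂))) z a b := by
        have e4 : fderiv ℝ (fderiv ℝ (fderiv ℝ (fderiv ℝ v))) z a b =
            fderiv ℝ (fderiv ℝ (fderiv ℝ (fderiv ℝ w₁))) z a b -
              fderiv ℝ (fderiv ℝ (fderiv ℝ (fderiv ℝ w₂))) z a b := by
          rw [d4 hzU]; rfl
        rw [← e4]
        ext c d
        have hev : (fun x => fderiv ℝ (fun z => fderiv ℝ (fderiv ℝ v) z a b) x d) =ᶠ[nhds z]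
            fun x => fderiv ℝ (fderiv ℝ (fderiv ℝ v)) x d a b := by
          filter_upwards [hU.mem_nhds hzU] with x hx
          have h2 := (c2 (hv4 x hx)).differentiableAt (by simp)
          rw [fderiv_apply_const (h2.clm_apply (differentiableAt_const a)), fderiv_apply_const h2]
        have h3 := (c3 (hv4 z hzU)).differentiableAt (by simp)
        have hu2 : ContDiffAt ℝ 2 (fun z => fderiv ℝ (fderiv ℝ v) z a b) z :=
          ((c2 (hv4 z hzU)).clm_apply contDiffAt_const).clm_apply contDiffAt_const
        have hu1 : DifferentiableAt ℝ (fderiv ℝ (fun z => fderiv ℝ (fderiv ℝ v) z a b)) z :=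
          (hu2.fderiv_right (m := 1) (by norm_num)).differentiableAt (by simp)
        rw [← fderiv_apply_const hu1, hev.fderiv_eq,
          fderiv_apply_const ((h3.clm_apply (differentiableAt_const d)).clm_apply
            (differentiableAt_const a)),
          fderiv_apply_const (h3.clm_apply (differentiableAt_const d)), fderiv_apply_const h3]
        exact fourth_deriv_symm (hv4 z hzU) c d a b
      rw [hD]
      have hΦ2 : ContDiff ℝ 2 (bilinDet e) := contDiff_bilinDet e
      have q₁ := second_deriv_comp_eq_zero hΦ2 (c2 (hw₁ z hzU).contDiffAt)
        (Filter.eventually_of_mem (hU.mem_nhds hzU) fun x hx => (hw₁ x hx).bilinDet_eq) a b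
      have q₂ := second_deriv_comp_eq_zero hΦ2 (c2 (hw₂ z hzU).contDiffAt)
        (Filter.eventually_of_mem (hU.mem_nhds hzU) fun x hx => (hw₂ x hx).bilinDet_eq) a b
      have hAz := hA z hz
      rw [d2 hzU] at hAz
      have hBz := hB z hz
      rw [d3 hzU] at hBz
      have hLip := hNl _ (hin₁ z hzU) _ (hin₂ z hzU)
      refine abs_linearized_le q₁ q₂ (hLip.1.trans (by gcongr)) (hLip.2.trans (by gcongr))
        (hNb _ (hin₂ z hzU)).2 (hopn _ _ (hw₁ z hzU).norm_three_le a ha)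
        (hopn _ _ (hw₁ z hzU).norm_three_le b hb) (hopn _ _ (hw₂ z hzU).norm_three_le a ha) ?_
        (hopn _ _ hBz a ha) (hopn _ _ hBz b hb)
      have := (fderiv ℝ (fderiv ℝ (fderiv ℝ (fderiv ℝ w₂))) z).le_opNorm₂ a b
      rw [ha, hb, mul_one, mul_one] at this
      exact this.trans (hw₂ z hzU).norm_four_le
  have hfin : κ * (A / ρ + ρ * (M * (A + B))) ≤ κ * (1 + M) * (A / ρ + ρ * (A + B)) := by
    have hκ0 : 0 ≤ κ := by positivity
    rw [mul_assoc κ]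
    refine mul_le_mul_of_nonneg_left ?_ hκ0
    have h1 : 0 ≤ M * (A / ρ) := by positivity
    have h2 : 0 ≤ ρ * (A + B) := by positivity
    linarith
  refine le_trans ?_ hfin
  refine ContinuousLinearMap.opNorm_le_of_unit_norm (by positivity) fun c hc => ?_
  refine ContinuousLinearMap.opNorm_le_of_unit_norm (by positivity) fun a ha => ?_
  refine ContinuousLinearMap.opNorm_le_of_unit_norm (by positivity) fun b hb => ?_
  have h2 := (c2 (hv4 y hyU)).differentiableAt (by simp)
  have h3 : fderiv ℝ (fun z => fderiv ℝ (fderiv ℝ v) z a b) y c =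
      fderiv ℝ (fderiv ℝ (fderiv ℝ v)) y c a b := by
    rw [fderiv_apply_const (h2.clm_apply (differentiableAt_const a)), fderiv_apply_const h2]
  rw [← h3]
  simpa [hc] using (fderiv ℝ (fun z => fderiv ℝ (fderiv ℝ v) z a b) y).le_of_opNorm_le
    (hest a b ha hb) c

end Difference

section Comparison

/-- Interior estimates for the difference of two bounded solutions. -/
theorem exists_norm_deriv_sub_le {ι : Type*} [Fintype ι] [DecidableEq ι] {E : Type*}
    [NormedAddCommGroup E] [InnerProductSpace ℝ E] [FiniteDimensional ℝ E]
    (e : OrthonormalBasis ι ℝ E) {C₀ R : ℝ} (hC₀ : 0 < C₀) (hR : 0 < R) (hR1 : R ≤ 1) :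
    ∃ C > 0, ∀ (U : Set E) (w₁ w₂ : E → ℝ) (δ : ℝ) (x : E), IsOpen U → closedBall x R ⊆ U →
      (∀ z ∈ U, IsBoundedSolutionAt e C₀ w₁ z) → (∀ z ∈ U, IsBoundedSolutionAt e C₀ w₂ z) →
      (∀ z ∈ U, |w₁ z - w₂ z| ≤ δ) →
        ‖fderiv ℝ (fun y => w₁ y - w₂ y) x‖ ≤ C * δ ∧
        ‖fderiv ℝ (fderiv ℝ (fun y => w₁ y - w₂ y)) x‖ ≤ C * δ ∧
        ‖fderiv ℝ (fderiv ℝ (fderiv ℝ (fun y => w₁ y - w₂ y))) x‖ ≤ C * δ := by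
  obtain ⟨C₁, hC₁, ρ₀, hρ₀, hloc⟩ := exists_norm_third_deriv_sub_le e hC₀
  obtain ⟨C₃, hC₃, habs⟩ := exists_norm_third_deriv_le (E := E) hC₁ hρ₀ (R := R / 2)
    (by positivity) (by linarith)
  set C₂ := 4 / (R / 8) ^ 2 + 2 * (R / 8) * C₃ with hC₂
  set C := 2 / (R / 4) + R / 4 * C₂ with hC
  have hC₂0 : 0 < C₂ := by positivity
  have hC0 : 0 < C := by positivity
  refine ⟨C + C₂ + C₃, by positivity, fun U w₁ w₂ δ x hU hball hw₁ hw₂ hδ => ?_⟩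
  set v : E → ℝ := fun y => w₁ y - w₂ y with hv
  have hv4 : ∀ z ∈ U, ContDiffAt ℝ 4 v z := fun z hz =>
    (hw₁ z hz).contDiffAt.sub (hw₂ z hz).contDiffAt
  have hδ0 : 0 ≤ δ := (abs_nonneg _).trans (hδ x (hball (mem_closedBall_self hR.le)))
  have hsub : ∀ {y : E} {r s : ℝ}, y ∈ closedBall x r → r + s ≤ R → closedBall y s ⊆ U :=
    fun {y r s} hy hrs => (closedBall_subset_closedBall' (by
      have := mem_closedBall.1 hy
      linarith)).trans hball
  have h3 : ∀ y ∈ closedBall x (R / 2), ‖fderiv ℝ (fderiv ℝ (fderiv ℝ v)) y‖ ≤ C₃ * δ := by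
    intro y hy
    have hyU : closedBall y (R / 2) ⊆ U := hsub hy (by linarith)
    exact habs v y δ (fun z hz => hv4 z (hyU hz)) (fun z hz => hδ z (hyU hz))
      fun p ρ A B hρ hρ' hp => hloc U w₁ w₂ hU hw₁ hw₂ p ρ A B hρ hρ' (hp.trans hyU)
  have h2 : ∀ y ∈ closedBall x (R / 4), ‖fderiv ℝ (fderiv ℝ v) y‖ ≤ C₂ * δ := by
    intro y hy
    have hyU : closedBall y (2 * (R / 8)) ⊆ U := hsub hy (by linarith)
    have := norm_hessian_le_interpolation (v := v) (y := y) (h := R / 8) (S := δ) (B := C₃ * δ)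
      (by positivity) (fun z hz => (hv4 z (hyU hz)).of_le (by norm_num))
      (fun z hz => hδ z (hyU hz)) fun z hz => h3 z <| mem_closedBall.2 <| by
        have h1 := mem_closedBall.1 hz
        have h2 := mem_closedBall.1 hy
        linarith [dist_triangle z y x]
    refine this.trans_eq ?_
    rw [hC₂]; ring
  have hx4 : closedBall x (R / 4) ⊆ U :=
    (closedBall_subset_closedBall (by linarith)).trans hball
  have h1 : ‖fderiv ℝ v x‖ ≤ C * δ := by
    have := norm_fderiv_le_interpolation (v := v) (y := x) (h := R / 4) (S := δ) (A := C₂ * δ)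
      (by positivity) (fun z hz => (hv4 z (hx4 hz)).of_le (by norm_num))
      (fun z hz => hδ z (hx4 hz)) h2
    refine this.trans_eq ?_
    rw [hC]; ring
  refine ⟨h1.trans ?_, (h2 x (mem_closedBall_self (by positivity))).trans ?_,
    (h3 x (mem_closedBall_self (by positivity))).trans ?_⟩ <;> gcongr <;> linarith

variable {E : Type*} [NormedAddCommGroup E] [NormedSpace ℝ E]

theorem norm_iteratedFDeriv_two_eq (w : E → ℝ) (x : E) :
    ‖iteratedFDeriv ℝ 2 w x‖ = ‖fderiv ℝ (fderiv ℝ w) x‖ := by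
  rw [← norm_iteratedFDeriv_fderiv, norm_iteratedFDeriv_one]

theorem norm_iteratedFDeriv_three_eq (w : E → ℝ) (x : E) :
    ‖iteratedFDeriv ℝ 3 w x‖ = ‖fderiv ℝ (fderiv ℝ (fderiv ℝ w)) x‖ := by
  rw [← norm_iteratedFDeriv_fderiv, ← norm_iteratedFDeriv_fderiv, norm_iteratedFDeriv_one]

theorem norm_iteratedFDeriv_four_eq (w : E → ℝ) (x : E) :
    ‖iteratedFDeriv ℝ 4 w x‖ = ‖fderiv ℝ (fderiv ℝ (fderiv ℝ (fderiv ℝ w))) x‖ := by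
  rw [← norm_iteratedFDeriv_fderiv, ← norm_iteratedFDeriv_fderiv, ← norm_iteratedFDeriv_fderiv,
    norm_iteratedFDeriv_one]

/-- A ball around a point of a set whose radius is less than the distance to the boundary is
contained in the set. -/
theorem closedBall_subset_of_lt_infDist_frontier {s : Set E} {x : E} {r : ℝ} (hx : x ∈ s)
    (hr : 0 ≤ r) (h : r < infDist x (frontier s)) : closedBall x r ⊆ s := by
  have hf : ∀ z ∈ closedBall x r, z ∉ frontier s := fun z hz hzf => by
    have := infDist_le_dist_of_mem (x := x) hzf
    rw [mem_closedBall'] at hz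
    linarith
  have hmem : ∀ z ∈ closedBall x r, z ∈ closure s → z ∈ interior s := fun z hz hzs => by
    by_contra hzi
    exact hf z hz ⟨hzs, hzi⟩
  have hxr : x ∈ closedBall x r := mem_closedBall_self hr
  refine ((convex_closedBall x r).isPreconnected.subset_left_of_subset_union isOpen_interior
    (isClosed_closure (s := s)).isOpen_compl ?_ (fun z hz => ?_)
    ⟨x, hxr, hmem x hxr (subset_closure hx)⟩).trans interior_subset
  · exact disjoint_compl_right.mono_left interior_subset_closure
  · by_cases hzs : z ∈ closure s
    · exact Or.inl (hmem z hz hzs)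
    · exact Or.inr hzs

theorem isBoundedSolutionAt_of_hessDet_eq {n : ℕ} {C₀ : ℝ}
    {Ω : Set (EuclideanSpace ℝ (Fin n))} {w : EuclideanSpace ℝ (Fin n) → ℝ} (hΩ : IsOpen Ω)
    (hw : ContDiffOn ℝ 4 w (closure Ω)) (hc : ConvexOn ℝ (closure Ω) w)
    (hdet : ∀ x ∈ Ω, hessDet w x = 1)
    (hb : ∀ x ∈ closure Ω, ∀ j ≤ 4, ‖iteratedFDerivWithin ℝ j w (closure Ω) x‖ ≤ C₀)
    {z : EuclideanSpace ℝ (Fin n)} (hz : z ∈ Ω) :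
    IsBoundedSolutionAt (EuclideanSpace.basisFun (Fin n) ℝ) C₀ w z := by
  have hnhds : closure Ω ∈ nhds z := Filter.mem_of_superset (hΩ.mem_nhds hz) subset_closure
  have hw4 : ContDiffAt ℝ 4 w z := hw.contDiffAt hnhds
  have hw2 : ContDiffAt ℝ 2 w z := hw4.of_le (by norm_num)
  have hb' : ∀ j ≤ 4, ‖iteratedFDeriv ℝ j w z‖ ≤ C₀ := fun j hj => by
    have := hb z (subset_closure hz) j hj
    rwa [iteratedFDerivWithin_congr_set (t := univ) (Filter.eventuallyEq_univ.2 hnhds),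
      iteratedFDerivWithin_univ] at this
  exact
    { contDiffAt := hw4
      bilinDet_eq := by rw [← hessDet_eq_bilinDet hw2, hdet z hz]
      nonneg := hessian_nonneg_of_convexOn hnhds hw2 hc
      norm_two_le := by rw [← norm_iteratedFDeriv_two_eq]; exact hb' 2 (by norm_num)
      norm_three_le := by rw [← norm_iteratedFDeriv_three_eq]; exact hb' 3 (by norm_num)
      norm_four_le := by rw [← norm_iteratedFDeriv_four_eq]; exact hb' 4 le_rfl }

end Comparison

end DerivativeEstimates

/-- Lemma 3.7: if `w₁, w₂` are convex solutions of `det D²w = 1` in a normalized convex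
domain `Ω`, with `C⁴` norms bounded by `C₀` and `|w₁ - w₂| ≤ δ` in `Ω`, then away from the
boundary `|Dᵏ(w₁ - w₂)| ≤ C δ` for `k = 1, 2, 3`. -/
theorem derivative_comparison (n : ℕ) (C₀ d₀ : ℝ) (hC₀ : 0 < C₀) (hd₀ : 0 < d₀)
    (k : ℕ) (hk : k ∈ ({1, 2, 3} : Set ℕ)) :
    ∃ C > (0:ℝ),
      ∀ (Ω : Set (EuclideanSpace ℝ (Fin n)))
        (w₁ w₂ : EuclideanSpace ℝ (Fin n) → ℝ) (δ : ℝ),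
        -- Ω is a bounded convex open domain with B₁(0) ⊆ Ω ⊆ Bₙ(0)
        Convex ℝ Ω → IsOpen Ω →
        ball (0 : EuclideanSpace ℝ (Fin n)) 1 ⊆ Ω →
        Ω ⊆ ball (0 : EuclideanSpace ℝ (Fin n)) n →
        -- w₁, w₂ ∈ C⁴(Ω̄) are convex with det D²wᵢ = 1 in Ω
        ContDiffOn ℝ 4 w₁ (closure Ω) → ContDiffOn ℝ 4 w₂ (closure Ω) →
        ConvexOn ℝ (closure Ω) w₁ → ConvexOn ℝ (closure Ω) w₂ →
        (∀ x ∈ Ω, hessDet w₁ x = 1) → (∀ x ∈ Ω, hessDet w₂ x = 1) →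
        -- the C⁴ norms of w₁, w₂ on Ω̄ are at most C₀
        (∀ x ∈ closure Ω, ∀ j ≤ 4, ‖iteratedFDerivWithin ℝ j w₁ (closure Ω) x‖ ≤ C₀) →
        (∀ x ∈ closure Ω, ∀ j ≤ 4, ‖iteratedFDerivWithin ℝ j w₂ (closure Ω) x‖ ≤ C₀) →
        -- |w₁ - w₂| ≤ δ in Ω
        0 < δ → (∀ x ∈ Ω, |w₁ x - w₂ x| ≤ δ) →
        -- conclusion: |Dᵏ(w₁ - w₂)| ≤ C δ at points at distance ≥ d₀ from ∂Ω
        ∀ x ∈ Ω, d₀ ≤ infDist x (frontier Ω) →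
          ‖iteratedFDerivWithin ℝ k (fun y => w₁ y - w₂ y) Ω x‖ ≤ C * δ := by
  obtain ⟨C, hC, hest⟩ := exists_norm_deriv_sub_le (EuclideanSpace.basisFun (Fin n) ℝ) hC₀
    (R := min (d₀ / 2) 1) (by positivity) (min_le_right _ _)
  refine ⟨C, hC, fun Ω w₁ w₂ δ _ hΩ _ _ hw₁ hw₂ hc₁ hc₂ hdet₁ hdet₂ hb₁ hb₂ _ hδ x hx hxd => ?_⟩
  have hlt : min (d₀ / 2) 1 < infDist x (frontier Ω) :=
    lt_of_lt_of_le ((min_le_left _ _).trans_lt (by linarith)) hxd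
  obtain ⟨h1, h2, h3⟩ := hest Ω w₁ w₂ δ x hΩ
    (closedBall_subset_of_lt_infDist_frontier hx (by positivity) hlt)
    (fun z hz => isBoundedSolutionAt_of_hessDet_eq hΩ hw₁ hc₁ hdet₁ hb₁ hz)
    (fun z hz => isBoundedSolutionAt_of_hessDet_eq hΩ hw₂ hc₂ hdet₂ hb₂ hz) hδ
  rw [iteratedFDerivWithin_of_isOpen k hΩ hx]
  rcases hk with rfl | rfl | rfl
  · rwa [norm_iteratedFDeriv_one]
  · rwa [norm_iteratedFDeriv_two_eq]
  · rwa [norm_iteratedFDeriv_three_eq]
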